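/- Let I be a Cohen-Macaulay R-ideal of positive grade, let e ≥ 1 be an integer, and let C be a proper R-ideal. Then L^e(I) ⊆ C·R(X) if and only if L^e(I) is not the unit ideal and every R-ideal that is linked to I in e steps is contained in C. -/

import Mathlib

open RingTheory IsLocalRing

/-- A proper ideal generated by a regular sequence is a complete intersection. -/
def IsCompleteIntersectionIdeal (R : Type) [CommRing R] (I : Ideal R) : Prop :=
  I ≠ ⊤ ∧ ∃ rs : List R, RingTheory.Sequence.IsRegular R rs ∧ Ideal.ofList rs = I

/-- Two proper ideals are directly linked if there is a complete intersection
`c ⊆ I ⊓ J` with `I = c : J` and `J = c : I`. -/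
def IsDirectlyLinked (R : Type) [CommRing R] (I J : Ideal R) : Prop :=
  I ≠ ⊤ ∧ J ≠ ⊤ ∧ ∃ c : Ideal R, IsCompleteIntersectionIdeal R c ∧ c ≤ I ⊓ J ∧
    Submodule.colon c J = I ∧ Submodule.colon c I = J

/-- The linkage (liaison) equivalence: the equivalence relation generated by direct linkage. -/
def InSameLinkageClass (R : Type) [CommRing R] (I J : Ideal R) : Prop :=
  Relation.EqvGen (IsDirectlyLinked R) I J

/-- An ideal is licci if its linkage class contains a complete intersection. -/
def Licci (R : Type) [CommRing R] (I : Ideal R) : Prop :=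
  ∃ J, InSameLinkageClass R I J ∧ IsCompleteIntersectionIdeal R J

open Classical in
/-- `∫ I` : the sum of all ideals in the linkage class of `I` if `I` is not licci,
and the unit ideal otherwise. -/
noncomputable def intLink (R : Type) [CommRing R] (I : Ideal R) : Ideal R :=
  if Licci R I then ⊤ else sSup {J : Ideal R | InSameLinkageClass R I J}

/-- An ideal is maximal in its linkage class if it contains every ideal in its linkage class. -/
def MaximalInLinkageClass (R : Type) [CommRing R] (I : Ideal R) : Prop :=
  ∀ J, InSameLinkageClass R I J → J ≤ I

/-- Linked in `n` steps. -/
def LinkedInSteps (R : Type) [CommRing R] : ℕ → Ideal R → Ideal R → Prop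
  | 0, I, J => I = J
  | (n+1), I, J => ∃ K, IsDirectlyLinked R I K ∧ LinkedInSteps R n K J

/-- The grade of an ideal: the supremum of lengths of regular sequences contained in it. -/
noncomputable def gradeOf (R : Type) [CommRing R] (I : Ideal R) : ℕ :=
  sSup {n : ℕ | ∃ rs : List R, rs.length = n ∧ (∀ r ∈ rs, r ∈ I) ∧
    RingTheory.Sequence.IsRegular R rs}

/-- A Noetherian local ring is Cohen-Macaulay if its depth (the grade of its maximal ideal)
equals its Krull dimension. -/
def IsCMLocalRing (A : Type) [CommRing A] [IsLocalRing A] : Prop :=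
  ringKrullDim A = (gradeOf A (maximalIdeal A) : WithBot (WithTop ℕ))

/-- An ideal `I` of `R` is a Cohen-Macaulay ideal if `R/I` is a Cohen-Macaulay local ring. -/
def IsCMIdeal (R : Type) [CommRing R] (I : Ideal R) : Prop :=
  ∃ h : IsLocalRing (R ⧸ I), @IsCMLocalRing (R ⧸ I) _ h

/-- A Noetherian local ring is Gorenstein if it is Cohen-Macaulay and some ideal generated
by a regular sequence and primary to the maximal ideal is irreducible. -/
def IsGorensteinLocalRing (A : Type) [CommRing A] [IsLocalRing A] : Prop :=
  IsCMLocalRing A ∧ ∃ rs : List A, RingTheory.Sequence.IsRegular A rs ∧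
    (Ideal.ofList rs).radical = maximalIdeal A ∧ InfIrred (Ideal.ofList rs)

open MvPolynomial in
/-- The first generic link `(α₁,…,α_g) : L·B[X]` built from a generating set `f` of `L`,
where `αᵢ = Σⱼ Xⱼᵢ·fⱼ`. -/
noncomputable def genericLinkIdeal {B : Type} [CommRing B] {n : ℕ} (g : ℕ)
    (f : Fin n → B) (L : Ideal B) : Ideal (MvPolynomial (Fin n × Fin g) B) :=
  Submodule.colon
    (Ideal.span (Set.range fun i : Fin g =>
      ∑ j : Fin n, (X (j, i) : MvPolynomial (Fin n × Fin g) B) * C (f j)))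
    (L.map (C : B →+* MvPolynomial (Fin n × Fin g) B))

/-- `IsGenericLinkOf R e I B φ L` says that `L ⊆ B` is an `e`-th generic link of `I`,
obtained by iterating the first generic link construction (with respect to some choice
of finite generating set at each stage); `φ : R →+* B` is the natural inclusion into the
iterated polynomial extension. -/
inductive IsGenericLinkOf (R : Type) [CommRing R] :
    ℕ → Ideal R → (B : CommRingCat.{0}) → (R →+* B) → Ideal B → Prop
  | zero (I : Ideal R) : IsGenericLinkOf R 0 I (CommRingCat.of R) (RingHom.id R) I
  | succ {e : ℕ} {I : Ideal R} {B : CommRingCat.{0}} {φ : R →+* B} {L : Ideal B}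
      (h : IsGenericLinkOf R e I B φ L) (n : ℕ) (f : Fin n → B)
      (hf : Ideal.span (Set.range f) = L) :
      IsGenericLinkOf R (e+1) I
        (CommRingCat.of (MvPolynomial (Fin n × Fin (gradeOf B L)) B))
        ((MvPolynomial.C : B →+* MvPolynomial (Fin n × Fin (gradeOf B L)) B).comp φ)
        (genericLinkIdeal (gradeOf B L) f L)

/-- `IsUniversalLinkOf R e I B φ L` says that `L ⊆ B` is an `e`-th universal link of `I`:
at each stage one passes from the current local ring `B'` to
`B'(X) = B'[X]` localized at the extension of the maximal ideal of `B'`, and extends the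
first generic link there. -/
inductive IsUniversalLinkOf (R : Type) [CommRing R] :
    ℕ → Ideal R → (B : CommRingCat.{0}) → (R →+* B) → Ideal B → Prop
  | zero (I : Ideal R) : IsUniversalLinkOf R 0 I (CommRingCat.of R) (RingHom.id R) I
  | succ {e : ℕ} {I : Ideal R} {B : CommRingCat.{0}} {φ : R →+* B} {L : Ideal B}
      (h : IsUniversalLinkOf R e I B φ L) (hB : IsLocalRing B) (n : ℕ) (f : Fin n → B)
      (hf : Ideal.span (Set.range f) = L)
      (hQ : (((@IsLocalRing.maximalIdeal B _ hB).map
          (MvPolynomial.C : B →+* MvPolynomial (Fin n × Fin (gradeOf B L)) B))).IsPrime) :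
      IsUniversalLinkOf R (e+1) I
        (CommRingCat.of (Localization (@Ideal.primeCompl _ _ _ hQ)))
        ((algebraMap (MvPolynomial (Fin n × Fin (gradeOf B L)) B)
            (Localization (@Ideal.primeCompl _ _ _ hQ))).comp
          ((MvPolynomial.C : B →+* MvPolynomial (Fin n × Fin (gradeOf B L)) B).comp φ))
        ((genericLinkIdeal (gradeOf B L) f L).map
          (algebraMap (MvPolynomial (Fin n × Fin (gradeOf B L)) B)
            (Localization (@Ideal.primeCompl _ _ _ hQ))))

namespace UniversalLink

set_option linter.unusedSectionVars false

section Reg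
variable {R : Type*} [CommRing R]

/-- `x` is a nonzerodivisor modulo the ideal `a`. -/
def RegMod (a : Ideal R) (x : R) : Prop := ∀ z, x * z ∈ a → z ∈ a

/-- The list is a (weakly) regular sequence modulo the ideal `a`. -/
def RegSeq : Ideal R → List R → Prop
  | _, [] => True
  | a, x :: l => RegMod a x ∧ RegSeq (a ⊔ Ideal.span {x}) l

theorem mem_sup_span_singleton {a : Ideal R} {x z : R} :
    z ∈ a ⊔ Ideal.span {x} ↔ ∃ w, z - w * x ∈ a := by
  rw [Submodule.mem_sup]
  constructor
  · rintro ⟨y, hy, t, ht, rfl⟩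
    obtain ⟨w, rfl⟩ := Ideal.mem_span_singleton'.1 ht
    exact ⟨w, by simpa using hy⟩
  · rintro ⟨w, hw⟩
    exact ⟨_, hw, w * x, Ideal.mem_span_singleton'.2 ⟨w, rfl⟩, by ring⟩

theorem regMod_top (x : R) : RegMod (⊤ : Ideal R) x := fun _ _ => trivial

theorem RegMod.swap {a : Ideal R} {x y : R} (hx : RegMod a x)
    (hy : RegMod (a ⊔ Ideal.span {x}) y) : RegMod (a ⊔ Ideal.span {y}) x := by
  intro z hz
  obtain ⟨w, hw⟩ := mem_sup_span_singleton.1 hz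
  have h1 : w ∈ a ⊔ Ideal.span {x} := by
    apply hy
    rw [mem_sup_span_singleton]
    refine ⟨z, ?_⟩
    have := a.neg_mem hw
    ring_nf at this ⊢
    exact this
  obtain ⟨u, hu⟩ := mem_sup_span_singleton.1 h1
  rw [mem_sup_span_singleton]
  refine ⟨u, hx _ ?_⟩
  have := a.add_mem hw (a.mul_mem_left y hu)
  ring_nf at this ⊢
  exact this

theorem sup_span_comm (a : Ideal R) (x y : R) :
    a ⊔ Ideal.span {x} ⊔ Ideal.span {y} = a ⊔ Ideal.span {y} ⊔ Ideal.span {x} :=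
  sup_right_comm _ _ _

theorem nakayama_le [IsLocalRing R] [IsNoetherianRing R] {W a : Ideal R} {x : R}
    (hx : x ∈ maximalIdeal R) (h : ∀ z ∈ W, ∃ w ∈ W, z - w * x ∈ a) : W ≤ a := by
  refine Submodule.le_of_le_smul_of_le_jacobson_bot (I := Ideal.span {x})
    (IsNoetherian.noetherian W) ?_ ?_
  · rw [IsLocalRing.jacobson_eq_maximalIdeal _ bot_ne_top, Ideal.span_le]
    simpa using hx
  · intro z hz
    obtain ⟨w, hw, hz'⟩ := h z hz
    rw [Submodule.mem_sup]
    refine ⟨_, hz', w * x, ?_, by ring⟩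
    rw [smul_eq_mul, mul_comm w]
    exact Ideal.mul_mem_mul (Ideal.mem_span_singleton_self x) hw

theorem RegMod.of_swap [IsLocalRing R] [IsNoetherianRing R] {a : Ideal R} {x y : R}
    (hxm : x ∈ maximalIdeal R) (hx : RegMod a x)
    (hy : RegMod (a ⊔ Ideal.span {x}) y) : RegMod a y := by
  intro z hz
  have : a.colon {y} ≤ a := by
    refine nakayama_le hxm fun z hz => ?_
    rw [Submodule.mem_colon_singleton, smul_eq_mul] at hz
    have h1 : z ∈ a ⊔ Ideal.span {x} :=
      hy _ ((le_sup_left : a ≤ _) (by rwa [mul_comm]))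
    obtain ⟨u, hu⟩ := mem_sup_span_singleton.1 h1
    refine ⟨u, ?_, hu⟩
    rw [Submodule.mem_colon_singleton, smul_eq_mul]
    apply hx
    have := a.sub_mem hz (a.mul_mem_left y hu)
    ring_nf at this ⊢
    exact this
  apply this
  rw [Submodule.mem_colon_singleton, smul_eq_mul, mul_comm]
  exact hz

theorem regSeq_append {a : Ideal R} {l l' : List R} :
    RegSeq a (l ++ l') ↔ RegSeq a l ∧ RegSeq (a ⊔ Ideal.ofList l) l' := by
  induction l generalizing a with
  | nil => simp [RegSeq]
  | cons x l ih => simp [RegSeq, ih, and_assoc, sup_assoc]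

theorem RegSeq.perm [IsLocalRing R] [IsNoetherianRing R] {a : Ideal R} {l l' : List R}
    (hp : l.Perm l') (hl : ∀ x ∈ l, x ∈ maximalIdeal R) (h : RegSeq a l) : RegSeq a l' := by
  induction hp generalizing a with
  | nil => exact h
  | cons x _ ih =>
    exact ⟨h.1, ih (fun y hy => hl y (List.mem_cons_of_mem _ hy)) h.2⟩
  | swap x y l =>
    refine ⟨RegMod.of_swap (hl _ (by simp)) h.1 h.2.1, h.1.swap h.2.1, ?_⟩
    rw [sup_span_comm]
    exact h.2.2
  | trans hp1 _ ih1 ih2 =>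
    exact ih2 (fun y hy => hl y (hp1.mem_iff.2 hy)) (ih1 hl h)

theorem regMod_iff_notMem_associatedPrimes [IsNoetherianRing R] {a : Ideal R} {x : R} :
    RegMod a x ↔ ∀ P ∈ associatedPrimes R (R ⧸ a), x ∉ P := by
  have key := biUnion_associatedPrimes_eq_zero_divisors R (R ⧸ a)
  have h2 : (∀ P ∈ associatedPrimes R (R ⧸ a), x ∉ P) ↔
      x ∉ ⋃ P ∈ associatedPrimes R (R ⧸ a), (P : Set R) := by simp
  rw [h2, key]
  simp only [Set.mem_ofPred_eq, not_exists, not_and]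
  constructor
  · intro h y hy hxy
    obtain ⟨y, rfl⟩ := Ideal.Quotient.mk_surjective y
    apply hy
    rw [Ideal.Quotient.eq_zero_iff_mem]
    apply h
    rw [← Ideal.Quotient.eq_zero_iff_mem]
    exact hxy
  · intro h z hz
    by_contra hza
    refine h (Ideal.Quotient.mk a z) (by rwa [Ne, Ideal.Quotient.eq_zero_iff_mem]) ?_
    change Ideal.Quotient.mk a (x * z) = 0
    rwa [Ideal.Quotient.eq_zero_iff_mem]

/-- Prime avoidance: an element of `Q` regular modulo two ideals at once. -/
theorem exists_regMod_both [IsNoetherianRing R] {Q a b : Ideal R}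
    (ha : ∃ x ∈ Q, RegMod a x) (hb : ∃ x ∈ Q, RegMod b x) :
    ∃ x ∈ Q, RegMod a x ∧ RegMod b x := by
  classical
  by_contra hcon
  push Not at hcon
  let s : Finset (Ideal R) := (associatedPrimes.finite R (R ⧸ a)).toFinset ∪
    (associatedPrimes.finite R (R ⧸ b)).toFinset
  have hsub : (Q : Set R) ⊆ ⋃ P ∈ (s : Set (Ideal R)), (P : Set R) := by
    intro x hx
    by_contra hx'
    simp only [s, Set.mem_iUnion, not_exists, Finset.coe_union, Set.Finite.coe_toFinset,
      Set.mem_union, SetLike.mem_coe] at hx'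
    exact hcon x hx (regMod_iff_notMem_associatedPrimes.2 fun P hP => hx' P (Or.inl hP))
      (regMod_iff_notMem_associatedPrimes.2 fun P hP => hx' P (Or.inr hP))
  have := (Ideal.subset_union_prime (f := fun P : Ideal R => P) ⊤ ⊤ (s := s) (by
    intro P hP _ _
    simp only [s, Finset.mem_union, Set.Finite.mem_toFinset] at hP
    rcases hP with hP | hP
    · exact hP.1
    · exact hP.1)).1 hsub
  obtain ⟨P, hP, hQ⟩ := this
  simp only [s, Finset.mem_union, Set.Finite.mem_toFinset] at hP
  rcases hP with hP | hP
  · obtain ⟨x, hx, hr⟩ := ha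
    exact regMod_iff_notMem_associatedPrimes.1 hr P hP (hQ hx)
  · obtain ⟨x, hx, hr⟩ := hb
    exact regMod_iff_notMem_associatedPrimes.1 hr P hP (hQ hx)

/-- If no element of `Q` is regular modulo `a`, then `Q` kills a nonzero element modulo `a`. -/
theorem exists_socle [IsNoetherianRing R] {Q a : Ideal R}
    (h : ¬ ∃ x ∈ Q, RegMod a x) : ∃ s, s ∉ a ∧ ∀ q ∈ Q, q * s ∈ a := by
  classical
  let s : Finset (Ideal R) := (associatedPrimes.finite R (R ⧸ a)).toFinset
  have hsub : (Q : Set R) ⊆ ⋃ P ∈ (s : Set (Ideal R)), (P : Set R) := by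
    intro x hx
    by_contra hx'
    simp only [s, Set.mem_iUnion, not_exists, Set.Finite.coe_toFinset,
      SetLike.mem_coe] at hx'
    exact h ⟨x, hx, regMod_iff_notMem_associatedPrimes.2 fun P hP => hx' P hP⟩
  obtain ⟨P, hP, hQ⟩ := (Ideal.subset_union_prime (f := fun P : Ideal R => P) ⊤ ⊤ (s := s) (by
    intro P hP _ _
    simp only [s, Set.Finite.mem_toFinset] at hP
    exact hP.1)).1 hsub
  simp only [s, Set.Finite.mem_toFinset] at hP
  obtain ⟨hprime, y, hy⟩ := isAssociatedPrime_iff.1 hP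
  obtain ⟨y, rfl⟩ := Ideal.Quotient.mk_surjective y
  refine ⟨y, fun hya => hprime.ne_top ?_, fun q hq => ?_⟩
  · rw [hy, Ideal.Quotient.eq_zero_iff_mem.2 hya]
    ext
    simp
  · have hqP := hQ hq
    rw [hy, Submodule.mem_colon_singleton] at hqP
    rw [← Ideal.Quotient.eq_zero_iff_mem]
    exact (Submodule.mem_bot R).1 hqP

theorem socle_exchange {Q a : Ideal R} {x y : R} (hyQ : y ∈ Q)
    (hx : RegMod a x) (hy : RegMod a y)
    (h : ∃ s, s ∉ a ⊔ Ideal.span {x} ∧ ∀ q ∈ Q, q * s ∈ a ⊔ Ideal.span {x}) :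
    ∃ s, s ∉ a ⊔ Ideal.span {y} ∧ ∀ q ∈ Q, q * s ∈ a ⊔ Ideal.span {y} := by
  obtain ⟨s, hs, hq⟩ := h
  obtain ⟨t, ht⟩ := mem_sup_span_singleton.1 (hq y hyQ)
  refine ⟨t, fun hta => hs ?_, fun q hqQ => ?_⟩
  · obtain ⟨w, hw⟩ := mem_sup_span_singleton.1 hta
    refine mem_sup_span_singleton.2 ⟨w, hy _ ?_⟩
    have := a.add_mem ht (a.mul_mem_left x hw)
    ring_nf at this ⊢
    exact this
  · obtain ⟨w, hw⟩ := mem_sup_span_singleton.1 (hq q hqQ)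
    refine mem_sup_span_singleton.2 ⟨w, hx _ ?_⟩
    have := a.sub_mem (a.mul_mem_left y hw) (a.mul_mem_left q ht)
    ring_nf at this ⊢
    exact this

/-- There is a regular sequence of length `r` in `Q` modulo `a` whose final ideal
satisfies `F`. -/
def RegChain (Q : Ideal R) (F : Ideal R → Prop) : ℕ → Ideal R → Prop
  | 0, a => F a
  | r + 1, a => ∃ x ∈ Q, RegMod a x ∧ RegChain Q F r (a ⊔ Ideal.span {x})

theorem RegChain.exchange [IsLocalRing R] [IsNoetherianRing R] {Q : Ideal R}
    (hQ : Q ≤ maximalIdeal R) {F : Ideal R → Prop}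
    (hF : ∀ a x y, x ∈ Q → y ∈ Q → RegMod a x → RegMod a y →
      F (a ⊔ Ideal.span {x}) → F (a ⊔ Ideal.span {y}))
    (r : ℕ) (a : Ideal R) (h : RegChain Q F (r + 1) a) (y : R) (hyQ : y ∈ Q)
    (hy : RegMod a y) : RegChain Q F r (a ⊔ Ideal.span {y}) := by
  induction r generalizing a y with
  | zero =>
    obtain ⟨x, hxQ, hx, h⟩ := h
    exact hF a x y hxQ hyQ hx hy h
  | succ r ih =>
    obtain ⟨x, hxQ, hx, h⟩ := h
    have hx2 : ∃ z ∈ Q, RegMod (a ⊔ Ideal.span {x}) z := by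
      obtain ⟨z, hzQ, hz, -⟩ := h
      exact ⟨z, hzQ, hz⟩
    have hy2 : ∃ z ∈ Q, RegMod (a ⊔ Ideal.span {y}) z := by
      by_contra hcon
      obtain ⟨s, hs, hsQ⟩ := socle_exchange hxQ hy hx (exists_socle hcon)
      obtain ⟨z, hzQ, hz⟩ := hx2
      exact hs (hz _ (hsQ z hzQ))
    obtain ⟨z, hzQ, hzx, hzy⟩ := exists_regMod_both hx2 hy2
    have hza : RegMod a z := RegMod.of_swap (hQ hxQ) hx hzx
    have h1 := ih _ h z hzQ hzx
    rw [sup_span_comm] at h1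
    have h2 := ih (a ⊔ Ideal.span {z}) ⟨x, hxQ, hx.swap hzx, h1⟩ y hyQ (hy.swap hzy)
    rw [sup_span_comm] at h2
    exact ⟨z, hzQ, hzy, h2⟩

theorem RegChain.exchange_list [IsLocalRing R] [IsNoetherianRing R] {Q : Ideal R}
    (hQ : Q ≤ maximalIdeal R) {F : Ideal R → Prop}
    (hF : ∀ a x y, x ∈ Q → y ∈ Q → RegMod a x → RegMod a y →
      F (a ⊔ Ideal.span {x}) → F (a ⊔ Ideal.span {y}))
    (r : ℕ) (l : List R) (a : Ideal R) (h : RegChain Q F (l.length + r) a)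
    (hlQ : ∀ x ∈ l, x ∈ Q) (hl : RegSeq a l) : RegChain Q F r (a ⊔ Ideal.ofList l) := by
  induction l generalizing a with
  | nil => simpa using h
  | cons x l ih =>
    rw [Ideal.ofList_cons, ← sup_assoc]
    refine ih _ ?_ (fun y hy => hlQ y (List.mem_cons_of_mem _ hy)) hl.2
    refine RegChain.exchange hQ hF _ _ ?_ x (hlQ x (by simp)) hl.1
    rw [List.length_cons] at h
    convert h using 1
    omega

theorem RegChain.of_list {Q : Ideal R} {F : Ideal R → Prop}
    (r : ℕ) (l : List R) (a : Ideal R) (hlQ : ∀ x ∈ l, x ∈ Q) (hl : RegSeq a l)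
    (h : RegChain Q F r (a ⊔ Ideal.ofList l)) : RegChain Q F (l.length + r) a := by
  induction l generalizing a with
  | nil => simpa using h
  | cons x l ih =>
    rw [Ideal.ofList_cons, ← sup_assoc] at h
    have := ih _ (fun y hy => hlQ y (List.mem_cons_of_mem _ hy)) hl.2 h
    rw [List.length_cons, show l.length + 1 + r = (l.length + r) + 1 by omega]
    exact ⟨x, hlQ x (by simp), hl.1, this⟩

theorem RegChain.mono {Q : Ideal R} {F G : Ideal R → Prop} (hFG : ∀ a, F a → G a)
    {r : ℕ} {a : Ideal R} (h : RegChain Q F r a) : RegChain Q G r a := by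
  induction r generalizing a with
  | zero => exact hFG _ h
  | succ r ih =>
    obtain ⟨x, hxQ, hx, h⟩ := h
    exact ⟨x, hxQ, hx, ih h⟩

theorem RegChain.exists_list {Q : Ideal R} {F : Ideal R → Prop}
    {r : ℕ} {a : Ideal R} (h : RegChain Q F r a) :
    ∃ l : List R, l.length = r ∧ (∀ x ∈ l, x ∈ Q) ∧ RegSeq a l ∧ F (a ⊔ Ideal.ofList l) := by
  induction r generalizing a with
  | zero => exact ⟨[], rfl, by simp, trivial, by simpa [RegChain] using h⟩
  | succ r ih =>
    obtain ⟨x, hxQ, hx, h⟩ := h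
    obtain ⟨l, hl, hlQ, hr, hF⟩ := ih h
    exact ⟨x :: l, by simp [hl], by simpa using ⟨hxQ, hlQ⟩, ⟨hx, hr⟩,
      by rwa [Ideal.ofList_cons, ← sup_assoc]⟩

end Reg

section Gor
variable {R : Type*} [CommRing R] [IsLocalRing R]

/-- `R ⧸ a` is a zero-dimensional local Gorenstein ring: `a` is primary to the maximal ideal and
the socle of `R ⧸ a` is simple. -/
def ArtinGor (a : Ideal R) : Prop :=
  (∃ n, maximalIdeal R ^ n ≤ a) ∧ ∃ s, s ∉ a ∧ (∀ m ∈ maximalIdeal R, m * s ∈ a) ∧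
    ∀ z, (∀ m ∈ maximalIdeal R, m * z ∈ a) → ∃ c, z - c * s ∈ a

/-- `R ⧸ a` is a local Gorenstein ring of dimension `r`. -/
def Gor (r : ℕ) (a : Ideal R) : Prop := RegChain (maximalIdeal R) ArtinGor r a

/-- `R ⧸ a` has a (weakly) regular sequence of length `r`. -/
def Dep (r : ℕ) (a : Ideal R) : Prop := RegChain (maximalIdeal R) (fun _ => True) r a

variable [IsNoetherianRing R]

theorem notMem_of_mem_minimalPrimes {a p : Ideal R} (hp : p ∈ a.minimalPrimes) {y : R}
    (hy : RegMod a y) : y ∉ p := by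
  refine regMod_iff_notMem_associatedPrimes.1 hy p ?_
  refine Module.associatedPrimes.minimalPrimes_annihilator_subset_associatedPrimes R (R ⧸ a) ?_
  rwa [Ideal.annihilator_quotient]

theorem pow_le_exchange {a : Ideal R} {x y : R}
    (hx : x ∈ maximalIdeal R) (hyr : RegMod a y)
    (h : ∃ n, maximalIdeal R ^ n ≤ a ⊔ Ideal.span {x}) :
    ∃ n, maximalIdeal R ^ n ≤ a ⊔ Ideal.span {y} := by
  refine Ideal.exists_pow_le_of_le_radical_of_fg ?_ (IsNoetherian.noetherian _)
  rw [Ideal.radical_eq_sInf]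
  refine le_sInf ?_
  rintro P ⟨hP, hPprime⟩
  have haP : a ≤ P := le_sup_left.trans hP
  have hyP : y ∈ P := hP (mem_sup_span_singleton.2 ⟨1, by simp⟩)
  obtain ⟨p, hp, hpP⟩ := Ideal.exists_minimalPrimes_le haP
  have hyp := notMem_of_mem_minimalPrimes hp hyr
  have hpprime : p.IsPrime := hp.1.1
  by_contra hcon
  have hPm : P < maximalIdeal R :=
    lt_of_le_of_ne (le_maximalIdeal hPprime.ne_top) fun h => hcon h.ge
  have hmin : maximalIdeal R ∈ (p ⊔ Ideal.span {x}).minimalPrimes := by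
    refine ⟨⟨inferInstance, sup_le (hpP.trans hPm.le) (by simpa using hx)⟩, ?_⟩
    rintro Q ⟨hQ, hQx⟩ -
    obtain ⟨n, hn⟩ := h
    exact hQ.le_of_pow_le (hn.trans ((sup_le_sup_right hp.1.2 _).trans hQx))
  have h1 := Ideal.map_height_le_one_of_mem_minimalPrimes hmin
  have hk : RingHom.ker (Ideal.Quotient.mk p) ≤ P := by rwa [Ideal.mk_ker]
  have hk' : RingHom.ker (Ideal.Quotient.mk p) ≤ maximalIdeal R := hk.trans hPm.le
  have i1 : (P.map (Ideal.Quotient.mk p)).IsPrime :=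
    Ideal.map_isPrime_of_surjective Ideal.Quotient.mk_surjective hk
  have i2 : ((maximalIdeal R).map (Ideal.Quotient.mk p)).IsPrime :=
    Ideal.map_isPrime_of_surjective Ideal.Quotient.mk_surjective hk'
  have hlt : P.map (Ideal.Quotient.mk p) < (maximalIdeal R).map (Ideal.Quotient.mk p) := by
    refine lt_of_le_of_ne (Ideal.map_mono hPm.le) fun heq => hPm.ne ?_
    have := congrArg (Ideal.comap (Ideal.Quotient.mk p)) heq
    rwa [Ideal.comap_map_of_surjective' _ Ideal.Quotient.mk_surjective,
      Ideal.comap_map_of_surjective' _ Ideal.Quotient.mk_surjective,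
      sup_eq_left.2 hk, sup_eq_left.2 hk'] at this
  have h2 := (Ideal.height_add_one_le_of_lt_of_isPrime hlt).trans h1
  have h3 : (P.map (Ideal.Quotient.mk p)).height = 0 := by
    have : (P.map (Ideal.Quotient.mk p)).height + 1 ≤ 0 + 1 := by simpa using h2
    exact nonpos_iff_eq_zero.1 ((ENat.add_le_add_iff_right ENat.one_ne_top).1 this)
  rw [Ideal.height_eq_zero_iff_eq_bot] at h3
  have h4 : Ideal.Quotient.mk p y ∈ P.map (Ideal.Quotient.mk p) := Ideal.mem_map_of_mem _ hyP
  rw [h3, Ideal.mem_bot, Ideal.Quotient.eq_zero_iff_mem] at h4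
  exact hyp h4

theorem artinGor_exchange (a : Ideal R) (x y : R) (hx : x ∈ maximalIdeal R)
    (hy : y ∈ maximalIdeal R) (hxr : RegMod a x) (hyr : RegMod a y)
    (h : ArtinGor (a ⊔ Ideal.span {x})) : ArtinGor (a ⊔ Ideal.span {y}) := by
  refine ⟨pow_le_exchange hx hyr h.1, ?_⟩
  obtain ⟨-, s, hs, hms, hu⟩ := h
  obtain ⟨t, ht⟩ := mem_sup_span_singleton.1 (hms y hy)
  refine ⟨t, fun hta => hs ?_, fun q hqQ => ?_, fun z hz => ?_⟩
  · obtain ⟨w, hw⟩ := mem_sup_span_singleton.1 hta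
    refine mem_sup_span_singleton.2 ⟨w, hyr _ ?_⟩
    have := a.add_mem ht (a.mul_mem_left x hw)
    ring_nf at this ⊢
    exact this
  · obtain ⟨w, hw⟩ := mem_sup_span_singleton.1 (hms q hqQ)
    refine mem_sup_span_singleton.2 ⟨w, hxr _ ?_⟩
    have := a.sub_mem (a.mul_mem_left y hw) (a.mul_mem_left q ht)
    ring_nf at this ⊢
    exact this
  · obtain ⟨w, hw⟩ := mem_sup_span_singleton.1 (hz x hx)
    obtain ⟨c, hc⟩ := hu w (fun q hq => by
      obtain ⟨u, hu⟩ := mem_sup_span_singleton.1 (hz q hq)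
      refine mem_sup_span_singleton.2 ⟨u, hyr _ ?_⟩
      have := a.sub_mem (a.mul_mem_left x hu) (a.mul_mem_left q hw)
      ring_nf at this ⊢
      exact this)
    obtain ⟨d, hd⟩ := mem_sup_span_singleton.1 hc
    refine ⟨c, mem_sup_span_singleton.2 ⟨d, hxr _ ?_⟩⟩
    have := a.add_mem (a.add_mem hw (a.mul_mem_left y hd)) (a.mul_mem_left c ht)
    ring_nf at this ⊢
    exact this

theorem Gor.exchange {r : ℕ} {a : Ideal R} (h : Gor (r + 1) a) {y : R}
    (hy : y ∈ maximalIdeal R) (hyr : RegMod a y) : Gor r (a ⊔ Ideal.span {y}) :=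
  RegChain.exchange le_rfl artinGor_exchange r a h y hy hyr

theorem Dep.exchange {r : ℕ} {a : Ideal R} (h : Dep (r + 1) a) {y : R}
    (hy : y ∈ maximalIdeal R) (hyr : RegMod a y) : Dep r (a ⊔ Ideal.span {y}) :=
  RegChain.exchange le_rfl (fun _ _ _ _ _ _ _ _ => trivial) r a h y hy hyr

theorem Gor.exchange_list {r : ℕ} {a : Ideal R} (l : List R) (h : Gor (l.length + r) a)
    (hl : ∀ x ∈ l, x ∈ maximalIdeal R) (hr : RegSeq a l) : Gor r (a ⊔ Ideal.ofList l) :=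
  RegChain.exchange_list le_rfl artinGor_exchange r l a h hl hr

theorem Dep.exchange_list {r : ℕ} {a : Ideal R} (l : List R) (h : Dep (l.length + r) a)
    (hl : ∀ x ∈ l, x ∈ maximalIdeal R) (hr : RegSeq a l) : Dep r (a ⊔ Ideal.ofList l) :=
  RegChain.exchange_list le_rfl (fun _ _ _ _ _ _ _ _ => trivial) r l a h hl hr

theorem Gor.dep {r : ℕ} {a : Ideal R} (h : Gor r a) : Dep r a :=
  RegChain.mono (fun _ _ => trivial) h

theorem Gor.not_dep_succ {r : ℕ} {a : Ideal R} (h : Gor r a) : ¬ Dep (r + 1) a := by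
  induction r generalizing a with
  | zero =>
    rintro ⟨x, hx, hr, -⟩
    obtain ⟨-, s, hs, hms, -⟩ := h
    exact hs (hr s (hms x hx))
  | succ r ih =>
    intro hd
    obtain ⟨x, hx, hr, h⟩ := h
    exact ih h (hd.exchange hx hr)

theorem Dep.of_succ {r : ℕ} {a : Ideal R} (h : Dep (r + 1) a) : Dep r a := by
  induction r generalizing a with
  | zero => trivial
  | succ r ih =>
    obtain ⟨x, hx, hr, h⟩ := h
    exact ⟨x, hx, hr, ih h⟩

theorem Dep.of_le {r s : ℕ} {a : Ideal R} (hs : r ≤ s) (h : Dep s a) : Dep r a := by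
  induction s, hs using Nat.le_induction with
  | base => exact h
  | succ n _ ih => exact ih h.of_succ

theorem dep_top (r : ℕ) : Dep r (⊤ : Ideal R) := by
  induction r with
  | zero => trivial
  | succ r ih => exact ⟨0, zero_mem _, regMod_top _, by rwa [top_sup_eq]⟩

theorem dep_of_regSeq {a : Ideal R} {l : List R} (hl : ∀ x ∈ l, x ∈ maximalIdeal R)
    (h : RegSeq a l) : Dep l.length a :=
  RegChain.of_list 0 l a hl h trivial

theorem Gor.length_le {r : ℕ} {a : Ideal R} (h : Gor r a) {l : List R}
    (hl : ∀ x ∈ l, x ∈ maximalIdeal R) (hr : RegSeq a l) : l.length ≤ r := by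
  by_contra hcon
  exact h.not_dep_succ ((dep_of_regSeq hl hr).of_le (by omega))

theorem Gor.ne_top {r : ℕ} {a : Ideal R} (h : Gor r a) : a ≠ ⊤ := by
  rintro rfl
  exact h.not_dep_succ (dep_top _)

end Gor

section Duality
variable {R : Type*} [CommRing R]

theorem mem_colon_ideal {a K : Ideal R} {z : R} :
    z ∈ a.colon (K : Set R) ↔ ∀ k ∈ K, z * k ∈ a := Submodule.mem_colon

/-- Every homomorphism `K ⧸ a → R ⧸ a` is a multiplication, stated in terms of generators. -/
def HomIsMul (a K : Ideal R) : Prop :=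
  ∀ (n : ℕ) (k v : Fin n → R), Ideal.span (Set.range k) = K →
    (∀ ρ : Fin n → R, ∑ j, ρ j * k j ∈ a → ∑ j, ρ j * v j ∈ a) →
    ∃ b, ∀ j, v j - b * k j ∈ a

theorem mem_span_range {n : ℕ} {k : Fin n → R} {z : R} :
    z ∈ Ideal.span (Set.range k) ↔ ∃ ρ : Fin n → R, ∑ j, ρ j * k j = z :=
  Ideal.mem_span_range_iff_exists_fun

theorem le_colon_colon (a K : Ideal R) : K ≤ a.colon (a.colon (K : Set R) : Set R) := by
  intro z hz
  rw [mem_colon_ideal]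
  intro u hu
  rw [mul_comm]
  exact mem_colon_ideal.1 hu z hz

theorem le_colon (a K : Ideal R) : a ≤ a.colon (K : Set R) := fun _ hz =>
  mem_colon_ideal.2 fun k _ => a.mul_mem_right k hz

theorem RegMod.colon {a : Ideal R} {x : R} (hx : RegMod a x) (K : Ideal R) :
    RegMod (a.colon (K : Set R)) x := by
  intro z hz
  rw [mem_colon_ideal] at hz ⊢
  intro k hk
  apply hx
  rw [← mul_assoc]
  exact hz k hk

theorem HomIsMul.colon_sup [IsNoetherianRing R] {a K : Ideal R} (h : HomIsMul a K) {x : R}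
    (hx : RegMod a x) :
    (a ⊔ Ideal.span {x}).colon (K ⊔ Ideal.span {x} : Ideal R) =
      a.colon (K : Set R) ⊔ Ideal.span {x} := by
  apply le_antisymm
  · intro z hz
    rw [mem_colon_ideal] at hz
    obtain ⟨n, k, hk⟩ := Submodule.fg_iff_exists_fin_generating_family.1
      (IsNoetherian.noetherian K)
    have hkK : ∀ j, k j ∈ K := fun j => hk ▸ Submodule.subset_span ⟨j, rfl⟩
    choose v hv using fun j =>
      mem_sup_span_singleton.1 (hz (k j) ((le_sup_left : K ≤ _) (hkK j)))
    obtain ⟨b, hb⟩ := h n k v hk (fun ρ hρ => by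
      apply hx
      have h1 : ∑ j, ρ j * (z * k j - v j * x) ∈ a :=
        a.sum_mem fun j _ => a.mul_mem_left _ (hv j)
      have h2 := a.sub_mem (a.mul_mem_left z hρ) h1
      convert h2 using 1
      rw [Finset.mul_sum, Finset.mul_sum, ← Finset.sum_sub_distrib]
      exact Finset.sum_congr rfl fun j _ => by ring)
    refine mem_sup_span_singleton.2 ⟨b, mem_colon_ideal.2 fun w hw => ?_⟩
    rw [← hk] at hw
    obtain ⟨ρ, rfl⟩ := mem_span_range.1 hw
    rw [Finset.mul_sum]
    refine a.sum_mem fun j _ => ?_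
    have := a.mul_mem_left (ρ j) (a.add_mem (hv j) (a.mul_mem_left x (hb j)))
    ring_nf at this ⊢
    exact this
  · refine sup_le (fun z hz => ?_) ?_
    · rw [mem_colon_ideal] at hz ⊢
      intro w hw
      obtain ⟨u, hu⟩ := mem_sup_span_singleton.1 hw
      refine mem_sup_span_singleton.2 ⟨z * u, ?_⟩
      have := hz _ hu
      convert this using 1
      ring
    · exact le_sup_right.trans (le_colon _ _)

variable [IsLocalRing R] [IsNoetherianRing R]

theorem exists_socle_of_pow_le {K K' : Ideal R} (hK : K' < K)
    (h : ∃ n, maximalIdeal R ^ n ≤ K') :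
    ∃ x ∈ K, x ∉ K' ∧ ∀ m ∈ maximalIdeal R, m * x ∈ K' := by
  classical
  have hex : ∃ n, maximalIdeal R ^ n * K ≤ K' := by
    obtain ⟨n, hn⟩ := h
    exact ⟨n, Ideal.mul_le_left.trans hn⟩
  obtain ⟨n, hn, hmin⟩ : ∃ n, maximalIdeal R ^ n * K ≤ K' ∧
      ∀ j < n, ¬ maximalIdeal R ^ j * K ≤ K' :=
    ⟨Nat.find hex, Nat.find_spec hex, fun j hj => Nat.find_min hex hj⟩
  rcases n with _ | n
  · rw [pow_zero, one_mul] at hn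
    exact absurd hn hK.not_ge
  · obtain ⟨x, hx, hxK⟩ := Set.not_subset.1 (hmin n (Nat.lt_succ_self n))
    refine ⟨x, Ideal.mul_le_right hx, hxK, fun m hm => hn ?_⟩
    rw [pow_succ', mul_assoc]
    exact Ideal.mul_mem_mul hm hx

theorem artin_induction {a K : Ideal R} (haK : a ≤ K) (hm : ∃ n, maximalIdeal R ^ n ≤ a)
    (P : Ideal R → Prop) (h0 : P a)
    (hs : ∀ K', a ≤ K' → K' ≤ K → P K' → ∀ x ∈ K, x ∉ K' →
      (∀ m ∈ maximalIdeal R, m * x ∈ K') → P (K' ⊔ Ideal.span {x})) : P K := by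
  obtain ⟨K', ⟨haK', hK'K, hP⟩, hmax⟩ :=
    WellFounded.has_min (wellFounded_gt (α := Ideal R))
      {K' : Ideal R | a ≤ K' ∧ K' ≤ K ∧ P K'} ⟨a, le_rfl, haK, h0⟩
  by_cases hK : K' = K
  · rwa [← hK]
  · exfalso
    obtain ⟨x, hx, hxK', hmx⟩ := exists_socle_of_pow_le (lt_of_le_of_ne hK'K hK)
      (hm.imp fun n hn => hn.trans haK')
    refine hmax (K' ⊔ Ideal.span {x}) ⟨haK'.trans le_sup_left, sup_le hK'K (by simpa using hx),
      hs K' haK' hK'K hP x hx hxK' hmx⟩ ?_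
    refine lt_of_le_of_ne le_sup_left fun h => hxK' ?_
    rw [h]
    exact mem_sup_span_singleton.2 ⟨1, by simp⟩

theorem ArtinGor.exists_mul {a : Ideal R} (h : ArtinGor a) {t : R} (ht : t ∉ a)
    (hmt : ∀ m ∈ maximalIdeal R, m * t ∈ a) {z : R} (hz : ∀ m ∈ maximalIdeal R, m * z ∈ a) :
    ∃ c, z - c * t ∈ a := by
  obtain ⟨-, s, hs, hms, hu⟩ := h
  obtain ⟨c, hc⟩ := hu t hmt
  obtain ⟨d, hd⟩ := hu z hz
  by_cases hcm : c ∈ maximalIdeal R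
  · exfalso
    apply ht
    simpa using a.add_mem hc (hms c hcm)
  · obtain ⟨c', hc'⟩ := (IsLocalRing.notMem_maximalIdeal.1 hcm).exists_left_inv
    refine ⟨d * c', ?_⟩
    have h1 := a.sub_mem hd (a.mul_mem_left (d * c') hc)
    have h2 : z - d * s - d * c' * (t - c * s) = z - d * c' * t + d * s * (c' * c - 1) := by
      ring
    rw [h2, hc'] at h1
    simpa using h1

theorem ArtinGor.colon_colon {a K : Ideal R} (h : ArtinGor a) (haK : a ≤ K) :
    a.colon (a.colon (K : Set R) : Set R) = K := by
  refine artin_induction haK h.1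
    (fun K => a.colon (a.colon (K : Set R) : Set R) = K) ?_ ?_
  · refine le_antisymm (fun z hz => ?_) (le_colon_colon _ _)
    have := mem_colon_ideal.1 hz 1 (mem_colon_ideal.2 fun k hk => by simpa using hk)
    simpa using this
  · intro K' haK' hK'K hP x hx hxK' hmx
    refine le_antisymm (fun y hy => ?_) (le_colon_colon _ _)
    obtain ⟨b, hb, hbx⟩ : ∃ b ∈ a.colon (K' : Set R), b * x ∉ a := by
      by_contra hcon
      push Not at hcon
      apply hxK'
      rw [← hP, mem_colon_ideal]
      intro u hu
      rw [mul_comm]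
      exact hcon u hu
    rw [mem_colon_ideal] at hb hy
    have hcol : ∀ u, (∀ k ∈ K', u * k ∈ a) → u * x ∈ a →
        u ∈ a.colon ((K' ⊔ Ideal.span {x} : Ideal R) : Set R) := by
      intro u hu hux
      rw [mem_colon_ideal]
      intro w hw
      obtain ⟨c, hc⟩ := mem_sup_span_singleton.1 hw
      have := a.add_mem (hu _ hc) (a.mul_mem_left c hux)
      convert this using 1
      ring
    have hsoc : ∀ u, (∀ k ∈ K', u * k ∈ a) → ∀ m ∈ maximalIdeal R, m * (u * x) ∈ a := by
      intro u hu m hm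
      have := hu _ (hmx m hm)
      ring_nf at this ⊢
      exact this
    obtain ⟨d, hd⟩ := h.exists_mul hbx (hsoc b hb) (z := y * b) (fun m hm => by
      have := hy (m * b) (hcol _ (fun k hk => by
        rw [mul_assoc]; exact a.mul_mem_left _ (hb k hk)) (by
          rw [mul_assoc]; exact hsoc b hb m hm))
      ring_nf at this ⊢
      exact this)
    refine mem_sup_span_singleton.2 ⟨d, ?_⟩
    rw [← hP, mem_colon_ideal]
    intro u hu
    rw [mem_colon_ideal] at hu
    obtain ⟨e, he⟩ := h.exists_mul hbx (hsoc b hb) (hsoc u hu)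
    have h1 := hy (u - e * b) (hcol _ (fun k hk => by
      have := a.sub_mem (hu k hk) (a.mul_mem_left e (hb k hk))
      ring_nf at this ⊢
      exact this) (by ring_nf at he ⊢; exact he))
    have h2 := a.sub_mem (a.add_mem h1 (a.mul_mem_left e hd)) (a.mul_mem_left d he)
    ring_nf at h2 ⊢
    exact h2

theorem ArtinGor.homIsMul {a K : Ideal R} (h : ArtinGor a) (haK : a ≤ K) : HomIsMul a K := by
  intro n k v hk hv
  have hkK : ∀ j, k j ∈ K := fun j => hk ▸ Submodule.subset_span ⟨j, rfl⟩
  obtain ⟨b, hb⟩ := artin_induction haK h.1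
    (fun K' => ∃ b, ∀ ρ : Fin n → R, ∑ j, ρ j * k j ∈ K' →
      ∑ j, ρ j * v j - b * ∑ j, ρ j * k j ∈ a) ⟨0, by simpa using hv⟩ (by
    rintro K' haK' hK'K ⟨b, hb⟩ x hx hxK' hmx
    obtain ⟨β, hβ, hβx⟩ : ∃ b ∈ a.colon (K' : Set R), b * x ∉ a := by
      by_contra hcon
      push Not at hcon
      apply hxK'
      rw [← h.colon_colon haK', mem_colon_ideal]
      intro u hu
      rw [mul_comm]
      exact hcon u hu
    rw [mem_colon_ideal] at hβ
    have hx' := hx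
    rw [← hk] at hx'
    obtain ⟨σ, rfl⟩ := mem_span_range.1 hx'
    obtain ⟨d, hd⟩ := h.exists_mul hβx (fun m hm => by
      have := hβ _ (hmx m hm)
      ring_nf at this ⊢
      exact this) (z := ∑ j, σ j * v j - b * ∑ j, σ j * k j) (fun m hm => by
      have := hb (fun j => m * σ j) (by
        have := hmx m hm
        simpa only [Finset.mul_sum, mul_assoc] using this)
      simp only [mul_assoc, ← Finset.mul_sum] at this
      rw [mul_sub]
      convert this using 2
      ring)
    refine ⟨b + d * β, fun ρ hρ => ?_⟩
    obtain ⟨c, hc⟩ := mem_sup_span_singleton.1 hρ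
    have h1 := hb (fun j => ρ j - c * σ j) (by
      simpa only [sub_mul, Finset.sum_sub_distrib, mul_assoc, ← Finset.mul_sum] using hc)
    simp only [sub_mul, Finset.sum_sub_distrib, mul_assoc, ← Finset.mul_sum] at h1
    have h2 := a.sub_mem (a.add_mem h1 (a.mul_mem_left c hd)) (a.mul_mem_left d (hβ _ hc))
    ring_nf at h2 ⊢
    exact h2)
  refine ⟨b, fun j => ?_⟩
  simpa [Pi.single_apply] using hb (Pi.single j 1) (by simpa [Pi.single_apply] using hkK j)

theorem HomIsMul.of_sup {a K : Ideal R} (haK : a ≤ K) {x : R} (hxm : x ∈ maximalIdeal R)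
    (hxa : RegMod a x) (hxK : RegMod K x)
    (h : HomIsMul (a ⊔ Ideal.span {x}) (K ⊔ Ideal.span {x})) : HomIsMul a K := by
  intro n k v hk hv
  let V : Submodule R (Fin n → R) :=
    { carrier := {v | ∀ ρ : Fin n → R, ∑ j, ρ j * k j ∈ a → ∑ j, ρ j * v j ∈ a}
      add_mem' := by
        intro u w hu hw ρ hρ
        simpa [mul_add, Finset.sum_add_distrib] using a.add_mem (hu ρ hρ) (hw ρ hρ)
      zero_mem' := by
        intro ρ _
        simp
      smul_mem' := by
        intro c u hu ρ hρ
        have := a.mul_mem_left c (hu ρ hρ)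
        rw [Finset.mul_sum] at this
        convert this using 2
        simp only [Pi.smul_apply, smul_eq_mul]
        ring }
  let W : Submodule R (Fin n → R) := Submodule.span R {k} ⊔ Submodule.pi Set.univ fun _ => a
  have hVW : V ≤ W := by
    refine Submodule.le_of_le_smul_of_le_jacobson_bot (I := Ideal.span {x})
      (IsNoetherian.noetherian V) ?_ ?_
    · rw [IsLocalRing.jacobson_eq_maximalIdeal _ bot_ne_top, Ideal.span_le]
      simpa using hxm
    · intro v hv
      obtain ⟨b, hb⟩ := h (n + 1) (Fin.cons x k) (Fin.cons 0 v) (by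
        rw [Fin.range_cons, Ideal.span_insert, hk, sup_comm]) (by
        intro ρ hρ
        simp only [Fin.sum_univ_succ, Fin.cons_zero, Fin.cons_succ, mul_zero, zero_add] at hρ ⊢
        obtain ⟨w, hw⟩ := mem_sup_span_singleton.1 hρ
        have hwK : w - ρ 0 ∈ K := by
          apply hxK
          have h1 : ∑ j : Fin n, ρ j.succ * k j ∈ K := K.sum_mem fun j _ =>
            K.mul_mem_left _ (hk ▸ Submodule.subset_span ⟨j, rfl⟩)
          have := K.sub_mem h1 (haK hw)
          ring_nf at this ⊢
          exact this
        rw [← hk] at hwK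
        obtain ⟨σ, hσ⟩ := mem_span_range.1 hwK
        have h2 := hv (fun j => ρ j.succ - x * σ j) (by
          simp only [sub_mul, Finset.sum_sub_distrib, mul_assoc, ← Finset.mul_sum]
          rw [hσ]
          ring_nf at hw ⊢
          exact hw)
        simp only [sub_mul, Finset.sum_sub_distrib, mul_assoc, ← Finset.mul_sum] at h2
        exact mem_sup_span_singleton.2 ⟨∑ j, σ j * v j, by rwa [mul_comm _ x]⟩)
      have hb' : ∀ j, ∃ w, v j - b * k j - w * x ∈ a := fun j =>
        mem_sup_span_singleton.1 (by simpa using hb j.succ)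
      choose w hw using hb'
      refine Submodule.mem_sup.2 ⟨v - x • w, ?_, x • w, ?_, by simp⟩
      · refine Submodule.mem_sup.2 ⟨b • k, Submodule.smul_mem _ _ (Submodule.mem_span_singleton_self k),
          v - x • w - b • k, ?_, by simp⟩
        rw [Submodule.mem_pi]
        intro j _
        have := hw j
        simp only [Pi.sub_apply, Pi.smul_apply, smul_eq_mul]
        convert this using 1
        ring
      · refine Submodule.smul_mem_smul (Ideal.mem_span_singleton_self x) ?_
        intro ρ hρ
        apply hxa
        have h1 : ∑ j, ρ j * (v j - b * k j - w j * x) ∈ a :=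
          a.sum_mem fun j _ => a.mul_mem_left _ (hw j)
        have h2 := a.sub_mem (a.sub_mem (hv ρ hρ) (a.mul_mem_left b hρ)) h1
        convert h2 using 1
        rw [Finset.mul_sum, Finset.mul_sum, ← Finset.sum_sub_distrib, ← Finset.sum_sub_distrib]
        exact Finset.sum_congr rfl fun j _ => by ring
  obtain ⟨u, hu, w, hw, huw⟩ := Submodule.mem_sup.1 (hVW (show v ∈ V from hv))
  obtain ⟨b, rfl⟩ := Submodule.mem_span_singleton.1 hu
  refine ⟨b, fun j => ?_⟩
  have := congrFun huw j
  simp only [Pi.add_apply, Pi.smul_apply, smul_eq_mul] at this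
  rw [← this, add_sub_cancel_left]
  exact (Submodule.mem_pi.1 hw) j trivial

/-- Linkage duality for a Cohen-Macaulay ideal `K` of maximal dimension containing a
Gorenstein ideal `a`. -/
theorem duality (r : ℕ) {a K : Ideal R} (haK : a ≤ K) (ha : Gor r a) (hK : Dep r K) :
    HomIsMul a K ∧ a.colon (a.colon (K : Set R) : Set R) = K ∧ Dep r (a.colon (K : Set R)) := by
  induction r generalizing a K with
  | zero => exact ⟨ArtinGor.homIsMul ha haK, ArtinGor.colon_colon ha haK, trivial⟩
  | succ r ih =>
    obtain ⟨x, hxm, hxa, hxK⟩ : ∃ x ∈ maximalIdeal R, RegMod a x ∧ RegMod K x :=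
      exists_regMod_both (ha.imp fun x h => ⟨h.1, h.2.1⟩) (hK.imp fun x h => ⟨h.1, h.2.1⟩)
    obtain ⟨h1, h2, h3⟩ := ih (sup_le_sup_right haK _) (ha.exchange hxm hxa) (hK.exchange hxm hxK)
    have hom : HomIsMul a K := HomIsMul.of_sup haK hxm hxa hxK h1
    have hcs := hom.colon_sup hxa
    refine ⟨hom, le_antisymm (nakayama_le hxm fun z hz => ?_) (le_colon_colon _ _),
      x, hxm, hxa.colon K, ?_⟩
    · have hz' : z ∈ K ⊔ Ideal.span {x} := by
        rw [← h2, hcs, mem_colon_ideal]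
        intro w hw
        obtain ⟨u, hu⟩ := mem_sup_span_singleton.1 hw
        refine mem_sup_span_singleton.2 ⟨z * u, ?_⟩
        have := mem_colon_ideal.1 hz _ hu
        convert this using 1
        ring
      obtain ⟨w, hw⟩ := mem_sup_span_singleton.1 hz'
      refine ⟨w, ?_, hw⟩
      apply hxa.colon
      have := Ideal.sub_mem _ hz (le_colon_colon a K hw)
      ring_nf at this ⊢
      exact this
    · rw [← hcs]
      exact h3

theorem colon_sup_ofList (r : ℕ) (l : List R) {a K : Ideal R} (haK : a ≤ K)
    (hl : ∀ x ∈ l, x ∈ maximalIdeal R) (ha : Gor (l.length + r) a) (hK : Dep (l.length + r) K)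
    (hla : RegSeq a l) (hlK : RegSeq K l) :
    (a ⊔ Ideal.ofList l).colon (K ⊔ Ideal.ofList l : Ideal R) =
      a.colon (K : Set R) ⊔ Ideal.ofList l ∧ RegSeq (a.colon (K : Set R)) l := by
  induction l generalizing a K with
  | nil => simp [RegSeq]
  | cons x l ih =>
    have hcs := (duality _ haK ha hK).1.colon_sup hla.1
    rw [List.length_cons, show l.length + 1 + r = l.length + r + 1 by omega] at ha hK
    have hxm := hl x (by simp)
    obtain ⟨h1, h2⟩ := ih (sup_le_sup_right haK _) (fun y hy => hl y (List.mem_cons_of_mem _ hy))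
      (ha.exchange hxm hla.1) (hK.exchange hxm hlK.1) hla.2 hlK.2
    rw [hcs] at h1 h2
    refine ⟨?_, hla.1.colon K, h2⟩
    rw [Ideal.ofList_cons, ← sup_assoc, ← sup_assoc, h1, sup_assoc]

end Duality

section MaxReg
variable {R : Type*} [CommRing R]

/-- There is a regular sequence of length `g` in `L` that is maximal, in the sense that `L`
annihilates a nonzero element modulo it. -/
def MaxReg (g : ℕ) (L : Ideal R) : Prop :=
  RegChain L (fun a => ∃ s, s ∉ a ∧ ∀ q ∈ L, q * s ∈ a) g ⊥

variable [IsLocalRing R] [IsNoetherianRing R]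

theorem MaxReg.of_list {g : ℕ} {L : Ideal R} (h : MaxReg g L) (hL : L ≠ ⊤) {l : List R}
    (hl : l.length = g) (hlL : ∀ x ∈ l, x ∈ L) (hr : RegSeq ⊥ l) :
    ∃ s, s ∉ Ideal.ofList l ∧ ∀ q ∈ L, q * s ∈ Ideal.ofList l := by
  have := RegChain.exchange_list (le_maximalIdeal hL)
    (F := fun a => ∃ s, s ∉ a ∧ ∀ q ∈ L, q * s ∈ a)
    (fun a x y hx _ hxr hyr h => socle_exchange ‹_› hxr hyr h) 0 l ⊥ (by rw [hl]; exact h) hlL hr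
  rwa [bot_sup_eq] at this

theorem MaxReg.length_le {g : ℕ} {L : Ideal R} (h : MaxReg g L) (hL : L ≠ ⊤) {l : List R}
    (hlL : ∀ x ∈ l, x ∈ L) (hr : RegSeq ⊥ l) : l.length ≤ g := by
  by_contra hcon
  push Not at hcon
  obtain ⟨s, hs, hLs⟩ := h.of_list hL (l := l.take g) (by simp [hcon.le])
    (fun x hx => hlL x (List.mem_of_mem_take hx)) (by
      rw [← List.take_append_drop g l, regSeq_append] at hr
      exact hr.1)
  rw [← List.take_append_drop g l, regSeq_append, bot_sup_eq, List.drop_eq_getElem_cons hcon] at hr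
  exact hs (hr.2.1 s (hLs _ (hlL _ (List.getElem_mem hcon))))

theorem MaxReg.exists_list {g : ℕ} {L : Ideal R} (h : MaxReg g L) :
    ∃ l : List R, l.length = g ∧ (∀ x ∈ l, x ∈ L) ∧ RegSeq ⊥ l ∧
      ∃ s, s ∉ Ideal.ofList l ∧ ∀ q ∈ L, q * s ∈ Ideal.ofList l := by
  obtain ⟨l, h1, h2, h3, h4⟩ := RegChain.exists_list h
  rw [bot_sup_eq] at h4
  exact ⟨l, h1, h2, h3, h4⟩

theorem MaxReg.of_exists {L : Ideal R} {l : List R}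
    (hlL : ∀ x ∈ l, x ∈ L) (hr : RegSeq ⊥ l) {s : R} (hs : s ∉ Ideal.ofList l)
    (hsL : ∀ q ∈ L, q * s ∈ Ideal.ofList l) : MaxReg l.length L := by
  refine RegChain.of_list 0 l ⊥ hlL hr ?_
  rw [bot_sup_eq]
  exact ⟨s, hs, hsL⟩

theorem MaxReg.unique {g g' : ℕ} {L : Ideal R} (h : MaxReg g L) (h' : MaxReg g' L)
    (hL : L ≠ ⊤) : g = g' := by
  obtain ⟨l, hl, hlL, hr, -⟩ := h.exists_list
  obtain ⟨l', hl', hlL', hr', -⟩ := h'.exists_list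
  have h1 := h.length_le hL hlL' hr'
  have h2 := h'.length_le hL hlL hr
  omega

theorem exists_maxReg {d : ℕ} (hd : Gor d (⊥ : Ideal R)) {L : Ideal R} (hL : L ≠ ⊤) :
    ∃ g, g ≤ d ∧ MaxReg g L := by
  classical
  have hm : ∀ l : List R, (∀ x ∈ l, x ∈ L) → ∀ x ∈ l, x ∈ maximalIdeal R :=
    fun l hl x hx => le_maximalIdeal hL (hl x hx)
  have hbdd : ∀ n, (∃ l : List R, l.length = n ∧ (∀ x ∈ l, x ∈ L) ∧ RegSeq ⊥ l) → n ≤ d := by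
    rintro _ ⟨l, rfl, hlL, hr⟩
    exact hd.length_le (hm l hlL) hr
  let g := Nat.findGreatest
    (fun n => ∃ l : List R, l.length = n ∧ (∀ x ∈ l, x ∈ L) ∧ RegSeq ⊥ l) d
  obtain ⟨l, hl, hlL, hr⟩ := Nat.findGreatest_spec
    (P := fun n => ∃ l : List R, l.length = n ∧ (∀ x ∈ l, x ∈ L) ∧ RegSeq ⊥ l) (n := d)
    (Nat.zero_le d) ⟨[], rfl, by simp, trivial⟩
  refine ⟨g, Nat.findGreatest_le d, ?_⟩
  obtain ⟨s, hs, hsL⟩ : ∃ s, s ∉ Ideal.ofList l ∧ ∀ q ∈ L, q * s ∈ Ideal.ofList l := by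
    apply exists_socle
    rintro ⟨x, hx, hxr⟩
    have hex : ∃ l' : List R, l'.length = g + 1 ∧ (∀ x ∈ l', x ∈ L) ∧ RegSeq ⊥ l' := by
      refine ⟨l ++ [x], by simp [hl, g], ?_, ?_⟩
      · simpa [or_imp, forall_and] using ⟨hlL, hx⟩
      · rw [regSeq_append, bot_sup_eq]
        exact ⟨hr, hxr, trivial⟩
    exact Nat.findGreatest_is_greatest (Nat.lt_succ_self g) (hbdd _ hex) hex
  have := MaxReg.of_exists hlL hr hs hsL
  rwa [hl] at this

/-- Krull dimensions of associated primes are bounded below by the depth. -/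
theorem Dep.le_ringKrullDim {r : ℕ} {a P : Ideal R} (hd : Dep r a) [P.IsPrime]
    (hP : ∃ s, ∀ p, p ∈ P ↔ p * s ∈ a) : (r : WithBot ℕ∞) ≤ ringKrullDim (R ⧸ P) := by
  induction r generalizing a P with
  | zero => simpa using ringKrullDim_nonneg_of_nontrivial
  | succ r ih =>
    obtain ⟨s, hs⟩ := hP
    obtain ⟨x, hxm, hx, hd⟩ := hd
    have hsa : s ∉ a := fun h => Ideal.IsPrime.ne_top ‹P.IsPrime›
      ((Ideal.eq_top_iff_one P).2 ((hs 1).2 (by simpa using h)))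
    obtain ⟨z, hz, hzx⟩ : ∃ z ∈ a.colon (P : Set R), z ∉ a ⊔ Ideal.span {x} := by
      by_contra hcon
      push Not at hcon
      apply hsa
      refine nakayama_le (W := a.colon (P : Set R)) hxm (fun z hz => ?_)
        (mem_colon_ideal.2 fun p hp => by rw [mul_comm]; exact (hs p).1 hp)
      obtain ⟨w, hw⟩ := mem_sup_span_singleton.1 (hcon z hz)
      refine ⟨w, mem_colon_ideal.2 fun p hp => hx _ ?_, hw⟩
      have := a.sub_mem (mem_colon_ideal.1 hz p hp) (a.mul_mem_left p hw)
      convert this using 1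
      ring
    obtain ⟨P', hP', hle⟩ := exists_le_isAssociatedPrime_of_isNoetherianRing R
      (Ideal.Quotient.mk (a ⊔ Ideal.span {x}) z) (by rwa [Ne, Ideal.Quotient.eq_zero_iff_mem])
    obtain ⟨hprime, y, hy⟩ := isAssociatedPrime_iff.1 hP'
    obtain ⟨y, rfl⟩ := Ideal.Quotient.mk_surjective y
    have hcol : ∀ p t : R, p ∈ (⊥ : Submodule R (R ⧸ (a ⊔ Ideal.span {x}))).colon
        {Ideal.Quotient.mk (a ⊔ Ideal.span {x}) t} ↔ p * t ∈ a ⊔ Ideal.span {x} := by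
      intro p t
      rw [Submodule.mem_colon_singleton, Submodule.mem_bot, ← Ideal.Quotient.eq_zero_iff_mem]
      rfl
    have h1 := ih (P := P') hd ⟨y, fun p => by rw [← hcol, ← hy]⟩
    have hPP : P ≤ P' := fun p hp => hle ((hcol p z).2
      ((le_sup_left : a ≤ _) (by rw [mul_comm]; exact mem_colon_ideal.1 hz p hp)))
    have hxP' : x ∈ P' := hle ((hcol x z).2 (mem_sup_span_singleton.2 ⟨z, by
      rw [mul_comm, sub_self]; exact zero_mem _⟩))
    have hxP : x ∉ P := fun h => hsa (hx _ ((hs x).1 h))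
    have h2 := ringKrullDim_succ_le_of_surjective (Ideal.Quotient.factor hPP)
      (Ideal.Quotient.factor_surjective hPP) (r := Ideal.Quotient.mk P x)
      (mem_nonZeroDivisors_of_ne_zero (by rwa [Ne, Ideal.Quotient.eq_zero_iff_mem]))
      (by rw [Ideal.Quotient.factor_mk, Ideal.Quotient.eq_zero_iff_mem]; exact hxP')
    refine le_trans ?_ h2
    push_cast
    gcongr

end MaxReg

section Pullback
variable {T R : Type*} [CommRing T] [CommRing R] {π : T →+* R}

theorem regMod_comap (hπ : Function.Surjective π) {a : Ideal R} {x : T} :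
    RegMod (a.comap π) x ↔ RegMod a (π x) := by
  constructor
  · intro h z hz
    obtain ⟨z, rfl⟩ := hπ z
    exact h z (by rwa [Ideal.mem_comap, map_mul])
  · intro h z hz
    exact h _ (by rwa [Ideal.mem_comap, map_mul] at hz)

theorem comap_sup_span (hπ : Function.Surjective π) (a : Ideal R) (x : T) :
    (a ⊔ Ideal.span {π x}).comap π = a.comap π ⊔ Ideal.span {x} := by
  ext z
  rw [Ideal.mem_comap, mem_sup_span_singleton, mem_sup_span_singleton]
  constructor
  · rintro ⟨w, hw⟩
    obtain ⟨w, rfl⟩ := hπ w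
    exact ⟨w, by simpa using hw⟩
  · rintro ⟨w, hw⟩
    exact ⟨π w, by simpa using hw⟩

theorem regSeq_comap (hπ : Function.Surjective π) {a : Ideal R} {l : List T} :
    RegSeq (a.comap π) l ↔ RegSeq a (l.map π) := by
  induction l generalizing a with
  | nil => simp [RegSeq]
  | cons x l ih => simp only [RegSeq, List.map_cons, regMod_comap hπ, ← ih, comap_sup_span hπ]

theorem RegChain.comap (hπ : Function.Surjective π) {Q : Ideal R} {Q' : Ideal T}
    (hQ : Q.comap π ≤ Q') {F : Ideal R → Prop} {F' : Ideal T → Prop}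
    (hF : ∀ a, F a → F' (a.comap π)) {r : ℕ} {a : Ideal R} (h : RegChain Q F r a) :
    RegChain Q' F' r (a.comap π) := by
  induction r generalizing a with
  | zero => exact hF a h
  | succ r ih =>
    obtain ⟨x, hxQ, hx, h⟩ := h
    obtain ⟨x, rfl⟩ := hπ x
    refine ⟨x, hQ hxQ, (regMod_comap hπ).2 hx, ?_⟩
    rw [← comap_sup_span hπ]
    exact ih h

variable [IsLocalRing T] [IsLocalRing R]

theorem comap_maximalIdeal_of_surjective (hπ : Function.Surjective π) :
    (maximalIdeal R).comap π = maximalIdeal T :=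
  IsLocalRing.eq_maximalIdeal (Ideal.comap_isMaximal_of_surjective π hπ)

theorem Dep.comap (hπ : Function.Surjective π) {r : ℕ} {a : Ideal R} (h : Dep r a) :
    Dep r (a.comap π) :=
  RegChain.comap hπ (comap_maximalIdeal_of_surjective hπ).le (fun _ _ => trivial) h

theorem ArtinGor.comap (hπ : Function.Surjective π) {a : Ideal R} (h : ArtinGor a) :
    ArtinGor (a.comap π) := by
  have hmem : ∀ m, m ∈ maximalIdeal T ↔ π m ∈ maximalIdeal R := fun m => by
    rw [← comap_maximalIdeal_of_surjective hπ, Ideal.mem_comap]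
  obtain ⟨⟨n, hn⟩, s, hs, hms, hu⟩ := h
  obtain ⟨s, rfl⟩ := hπ s
  refine ⟨⟨n, ?_⟩, s, hs, fun m hm => ?_, fun z hz => ?_⟩
  · rw [← comap_maximalIdeal_of_surjective hπ]
    exact (Ideal.le_comap_pow π n).trans (Ideal.comap_mono hn)
  · rw [Ideal.mem_comap, map_mul]
    exact hms _ ((hmem m).1 hm)
  · obtain ⟨c, hc⟩ := hu (π z) (fun m hm => by
      obtain ⟨m, rfl⟩ := hπ m
      have := hz m ((hmem m).2 hm)
      rwa [Ideal.mem_comap, map_mul] at this)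
    obtain ⟨c, rfl⟩ := hπ c
    exact ⟨c, by rwa [Ideal.mem_comap, map_sub, map_mul]⟩

theorem Gor.comap (hπ : Function.Surjective π) {r : ℕ} {a : Ideal R} (h : Gor r a) :
    Gor r (a.comap π) :=
  RegChain.comap hπ (comap_maximalIdeal_of_surjective hπ).le (fun _ h => ArtinGor.comap hπ h) h

end Pullback

section Init

theorem isSMulRegular_quotient_iff {R : Type*} [CommRing R] {a : Ideal R} {x : R} :
    IsSMulRegular (R ⧸ (a • ⊤ : Submodule R R)) x ↔ RegMod a x := by
  have h : (a • ⊤ : Submodule R R) = a := by simp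
  rw [h, isSMulRegular_iff_right_eq_zero_of_smul]
  constructor
  · intro h z hz
    rw [← Ideal.Quotient.eq_zero_iff_mem]
    apply h
    exact Ideal.Quotient.eq_zero_iff_mem.2 hz
  · intro h z hz
    obtain ⟨z, rfl⟩ := Ideal.Quotient.mk_surjective z
    exact Ideal.Quotient.eq_zero_iff_mem.2 (h z (Ideal.Quotient.eq_zero_iff_mem.1 hz))

theorem regSeq_iff_take {R : Type*} [CommRing R] {a : Ideal R} {l : List R} :
    RegSeq a l ↔ ∀ i, ∀ h : i < l.length, RegMod (a ⊔ Ideal.ofList (l.take i)) l[i] := by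
  induction l generalizing a with
  | nil => simp [RegSeq]
  | cons x l ih =>
    simp only [RegSeq, ih]
    constructor
    · rintro ⟨h1, h2⟩ (_ | i) hi
      · simpa using h1
      · simpa [sup_assoc] using h2 i (by simpa using hi)
    · intro h
      refine ⟨?_, fun i hi => ?_⟩
      · have h0 := h 0 (by simp)
        rw [List.take_zero, Ideal.ofList_nil, sup_bot_eq] at h0
        exact h0
      · have h1 := h (i + 1) (by simpa using hi)
        rw [List.take_succ_cons, Ideal.ofList_cons, ← sup_assoc] at h1
        exact h1

theorem isRegular_iff {R : Type*} [CommRing R] {l : List R} :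
    RingTheory.Sequence.IsRegular R l ↔ RegSeq ⊥ l ∧ Ideal.ofList l ≠ ⊤ := by
  rw [RingTheory.Sequence.isRegular_iff, RingTheory.Sequence.isWeaklyRegular_iff, regSeq_iff_take]
  simp only [isSMulRegular_quotient_iff, bot_sup_eq]
  refine and_congr Iff.rfl ?_
  rw [ne_comm]
  simp

theorem ofList_le {R : Type*} [CommRing R] {l : List R} {a : Ideal R} :
    Ideal.ofList l ≤ a ↔ ∀ x ∈ l, x ∈ a := Ideal.span_le

theorem ofList_ne_top_iff {R : Type*} [CommRing R] [IsLocalRing R] {l : List R} :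
    Ideal.ofList l ≠ ⊤ ↔ ∀ x ∈ l, x ∈ maximalIdeal R := by
  rw [← ofList_le]
  exact ⟨le_maximalIdeal, fun h => ne_top_of_le_ne_top (maximalIdeal.isMaximal R).ne_top h⟩

variable {R : Type} [CommRing R] [IsLocalRing R]

theorem isCompleteIntersectionIdeal_iff {c : Ideal R} : IsCompleteIntersectionIdeal R c ↔
    ∃ l : List R, (∀ x ∈ l, x ∈ maximalIdeal R) ∧ RegSeq ⊥ l ∧ Ideal.ofList l = c := by
  constructor
  · rintro ⟨-, l, hl, rfl⟩
    rw [isRegular_iff, ofList_ne_top_iff] at hl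
    exact ⟨l, hl.2, hl.1, rfl⟩
  · rintro ⟨l, hl, hr, rfl⟩
    rw [← ofList_ne_top_iff] at hl
    exact ⟨hl, l, isRegular_iff.2 ⟨hr, hl⟩, rfl⟩

variable [IsNoetherianRing R]

theorem MaxReg.gradeOf_eq {g : ℕ} {L : Ideal R} (h : MaxReg g L) (hL : L ≠ ⊤) :
    gradeOf R L = g := by
  apply IsGreatest.csSup_eq
  constructor
  · obtain ⟨l, hl, hlL, hr, -⟩ := h.exists_list
    exact ⟨l, hl, hlL, isRegular_iff.2
      ⟨hr, ne_top_of_le_ne_top hL (ofList_le.2 hlL)⟩⟩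
  · rintro _ ⟨l, rfl, hlL, hr⟩
    exact h.length_le hL hlL (isRegular_iff.1 hr).1

theorem one_le_gradeOf_top {d : ℕ} (hd : Gor (d + 1) (⊥ : Ideal R)) :
    1 ≤ gradeOf R (⊤ : Ideal R) := by
  have hd' := hd
  obtain ⟨x, hx, hr, -⟩ := hd'
  refine le_csSup ⟨d + 1, ?_⟩ ⟨[x], rfl, by simp, isRegular_iff.2
    ⟨⟨hr, trivial⟩, ofList_ne_top_iff.2 (by simpa using hx)⟩⟩
  rintro _ ⟨l, rfl, -, hr⟩
  rw [isRegular_iff, ofList_ne_top_iff] at hr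
  exact hd.length_le hr.2 hr.1

theorem exists_gor_bot (h : IsGorensteinLocalRing R) : ∃ d, Gor d (⊥ : Ideal R) := by
  obtain ⟨-, l, hl, hrad, hirr⟩ := h
  rw [isRegular_iff, ofList_ne_top_iff] at hl
  refine ⟨l.length, RegChain.of_list 0 l ⊥ hl.2 hl.1 ?_⟩
  rw [bot_sup_eq]
  have hpow : ∃ n, maximalIdeal R ^ n ≤ Ideal.ofList l :=
    Ideal.exists_pow_le_of_le_radical_of_fg hrad.ge (IsNoetherian.noetherian _)
  have htop : Ideal.ofList l < ⊤ := lt_top_iff_ne_top.2 (ofList_ne_top_iff.2 hl.2)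
  obtain ⟨s, -, hs, hms⟩ := exists_socle_of_pow_le htop hpow
  refine ⟨hpow, s, hs, hms, fun z hz => ?_⟩
  set a := Ideal.ofList l
  by_cases hza : z ∈ a
  · exact ⟨0, by simpa using hza⟩
  have hle : ¬ ((a ⊔ Ideal.span {z}) ⊓ (a ⊔ Ideal.span {s}) ≤ a) := by
    intro hle
    rcases hirr.2 (le_antisymm hle (le_inf le_sup_left le_sup_left)) with h | h
    · exact hza (h ▸ mem_sup_span_singleton.2 ⟨1, by simp⟩)
    · exact hs (h ▸ mem_sup_span_singleton.2 ⟨1, by simp⟩)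
  obtain ⟨w, ⟨hwz, hws⟩, hwa⟩ := Set.not_subset.1 hle
  obtain ⟨u, hu⟩ := mem_sup_span_singleton.1 hwz
  obtain ⟨v, hv⟩ := mem_sup_span_singleton.1 hws
  by_cases hum : u ∈ maximalIdeal R
  · exfalso
    apply hwa
    simpa using a.add_mem hu (hz u hum)
  · obtain ⟨u', hu'⟩ := (IsLocalRing.notMem_maximalIdeal.1 hum).exists_left_inv
    refine ⟨u' * v, ?_⟩
    have h1 := a.mul_mem_left u' (a.sub_mem hv hu)
    have h2 : u' * (w - v * s - (w - u * z)) = z - u' * v * s + (u' * u - 1) * z := by ring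
    rw [h2, hu'] at h1
    simpa using h1

theorem IsCMIdeal.ne_top {I : Ideal R} (h : IsCMIdeal R I) : I ≠ ⊤ := by
  obtain ⟨h, -⟩ := h
  exact Ideal.Quotient.nontrivial_iff.1 h.toNontrivial

theorem IsCMIdeal.exists_dep {I : Ideal R} (h : IsCMIdeal R I) :
    ∃ s : ℕ, ringKrullDim (R ⧸ I) = s ∧ Dep s I := by
  obtain ⟨hloc, hdim⟩ := h
  refine ⟨_, hdim, ?_⟩
  set S := {n : ℕ | ∃ rs : List (R ⧸ I), rs.length = n ∧
    (∀ r ∈ rs, r ∈ maximalIdeal (R ⧸ I)) ∧ RingTheory.Sequence.IsRegular (R ⧸ I) rs} with hS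
  have hgr : gradeOf (R ⧸ I) (maximalIdeal (R ⧸ I)) = sSup S := rfl
  rw [hgr]
  by_cases hb : BddAbove S
  · obtain ⟨l, hl, hlm, hlr⟩ : sSup S ∈ S := by
      refine Nat.sSup_mem ⟨0, [], rfl, by simp, isRegular_iff.2 ⟨trivial, ?_⟩⟩ hb
      rw [Ideal.ofList_nil]
      exact bot_ne_top
    rw [← hl]
    have h1 : Dep l.length (⊥ : Ideal (R ⧸ I)) := dep_of_regSeq hlm (isRegular_iff.1 hlr).1
    have h2 := h1.comap (π := Ideal.Quotient.mk I) Ideal.Quotient.mk_surjective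
    rwa [← RingHom.ker_eq_comap_bot, Ideal.mk_ker] at h2
  · have h0 : sSup S = 0 := by
      rw [csSup_of_not_bddAbove hb, csSup_empty, bot_eq_zero]
    rw [h0]
    trivial

/-- A Cohen-Macaulay ideal of grade `g` in a Gorenstein local ring of dimension `g + r` has
depth at least `r`. -/
theorem exists_init (hGor : IsGorensteinLocalRing R) {I : Ideal R} (hCM : IsCMIdeal R I)
    (hgrade : ∃ r ∈ I, r ∈ nonZeroDivisors R) :
    ∃ g r : ℕ, 1 ≤ g ∧ Gor (g + r) (⊥ : Ideal R) ∧ MaxReg g I ∧ Dep r I := by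
  obtain ⟨d, hd⟩ := exists_gor_bot hGor
  have hI := IsCMIdeal.ne_top hCM
  obtain ⟨g, hgd, hg⟩ := exists_maxReg hd hI
  obtain ⟨r, rfl⟩ := Nat.exists_eq_add_of_le hgd
  refine ⟨g, r, ?_, hd, hg, ?_⟩
  · obtain ⟨x, hx, hreg⟩ := hgrade
    refine hg.length_le hI (l := [x]) (by simpa using hx) ⟨fun z hz => ?_, trivial⟩
    rw [Ideal.mem_bot] at hz ⊢
    exact (mem_nonZeroDivisors_iff.1 hreg).1 z hz
  · obtain ⟨s, hs, hdep⟩ := IsCMIdeal.exists_dep hCM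
    refine hdep.of_le ?_
    obtain ⟨l, hl, hlI, hlr, t, ht, htI⟩ := hg.exists_list
    have hga : Gor r (Ideal.ofList l) := by
      have := Gor.exchange_list (r := r) l (by rwa [hl])
        (fun x hx => le_maximalIdeal hI (hlI x hx)) hlr
      rwa [bot_sup_eq] at this
    obtain ⟨P, hP, hle⟩ := exists_le_isAssociatedPrime_of_isNoetherianRing R
      (Ideal.Quotient.mk (Ideal.ofList l) t) (by rwa [Ne, Ideal.Quotient.eq_zero_iff_mem])
    obtain ⟨hprime, y, hy⟩ := isAssociatedPrime_iff.1 hP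
    obtain ⟨y, rfl⟩ := Ideal.Quotient.mk_surjective y
    have hcol : ∀ p t : R, p ∈ (⊥ : Submodule R (R ⧸ Ideal.ofList l)).colon
        {Ideal.Quotient.mk (Ideal.ofList l) t} ↔ p * t ∈ Ideal.ofList l := by
      intro p t
      rw [Submodule.mem_colon_singleton, Submodule.mem_bot, ← Ideal.Quotient.eq_zero_iff_mem]
      rfl
    have h1 := Dep.le_ringKrullDim (P := P) hga.dep ⟨y, fun p => by rw [← hcol, ← hy]⟩
    have hIP : I ≤ P := fun q hq => hle ((hcol q t).2 (htI q hq))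
    have h2 := h1.trans (ringKrullDim_le_of_surjective (Ideal.Quotient.factor hIP)
      (Ideal.Quotient.factor_surjective hIP))
    rw [hs] at h2
    exact_mod_cast h2

end Init

section Loc

/-- `ψ` exhibits `S` as the localization of `A` at the complement of `P`. -/
structure IsLocAt {A S : Type*} [CommRing A] [CommRing S] (P : Ideal A) (ψ : A →+* S) :
    Prop where
  isUnit : ∀ s, s ∉ P → IsUnit (ψ s)
  surj : ∀ b, ∃ a s, s ∉ P ∧ b * ψ s = ψ a
  eq_zero : ∀ a, ψ a = 0 → ∃ s, s ∉ P ∧ s * a = 0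

variable {A S : Type*} [CommRing A] [CommRing S] {P : Ideal A} {ψ : A →+* S}

theorem isLocAt_algebraMap [Algebra A S] [P.IsPrime] [IsLocalization.AtPrime S P] :
    IsLocAt P (algebraMap A S) where
  isUnit s hs := IsLocalization.map_units S (⟨s, hs⟩ : P.primeCompl)
  surj b := by
    obtain ⟨⟨a, s⟩, h⟩ := IsLocalization.surj P.primeCompl b
    exact ⟨a, s, s.2, h⟩
  eq_zero a ha := by
    obtain ⟨s, hs⟩ := (IsLocalization.map_eq_zero_iff P.primeCompl S a).1 ha
    exact ⟨s, s.2, hs⟩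

theorem IsLocAt.isLocalization [P.IsPrime] (h : IsLocAt P ψ) :
    @IsLocalization.AtPrime A _ S _ ψ.toAlgebra P _ := by
  let := ψ.toAlgebra
  refine ⟨fun s => h.isUnit s s.2, fun b => ?_, fun {x y} hxy => ?_⟩
  · obtain ⟨a, s, hs, e⟩ := h.surj b
    exact ⟨⟨a, ⟨s, hs⟩⟩, e⟩
  · obtain ⟨s, hs, e⟩ := h.eq_zero (x - y) (by rw [map_sub, sub_eq_zero]; exact hxy)
    exact ⟨⟨s, hs⟩, by rwa [mul_sub, sub_eq_zero] at e⟩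

theorem IsLocAt.isLocalRing [P.IsPrime] (h : IsLocAt P ψ) : IsLocalRing S := by
  let := ψ.toAlgebra
  have := h.isLocalization
  exact IsLocalization.AtPrime.isLocalRing S P

theorem IsLocAt.isNoetherianRing [P.IsPrime] (h : IsLocAt P ψ) [IsNoetherianRing A] :
    IsNoetherianRing S := by
  let := ψ.toAlgebra
  have := h.isLocalization
  exact IsLocalization.isNoetherianRing P.primeCompl S inferInstance

theorem IsLocAt.exists_of_mem_map [P.IsPrime] (h : IsLocAt P ψ) {K : Ideal A} {b : S}
    (hb : b ∈ K.map ψ) : ∃ k ∈ K, ∃ s, s ∉ P ∧ b * ψ s = ψ k := by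
  refine Submodule.span_induction (p := fun b _ => ∃ k ∈ K, ∃ s, s ∉ P ∧ b * ψ s = ψ k)
    ?_ ?_ ?_ ?_ hb
  · rintro _ ⟨k, hk, rfl⟩
    exact ⟨k, hk, 1, fun h1 => Ideal.IsPrime.ne_top ‹_› ((Ideal.eq_top_iff_one P).2 h1), by simp⟩
  · exact ⟨0, K.zero_mem, 1, fun h1 => Ideal.IsPrime.ne_top ‹_› ((Ideal.eq_top_iff_one P).2 h1),
      by simp⟩
  · rintro x y - - ⟨k, hk, s, hs, e⟩ ⟨k', hk', s', hs', e'⟩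
    refine ⟨k * s' + k' * s, K.add_mem (K.mul_mem_right _ hk) (K.mul_mem_right _ hk'), s * s',
      fun hm => (Ideal.IsPrime.mem_or_mem ‹_› hm).elim hs hs', ?_⟩
    rw [map_add, map_mul, map_mul, map_mul, ← e, ← e']
    ring
  · rintro c x - ⟨k, hk, s, hs, e⟩
    obtain ⟨a, t, ht, e'⟩ := h.surj c
    refine ⟨a * k, K.mul_mem_left _ hk, t * s,
      fun hm => (Ideal.IsPrime.mem_or_mem ‹_› hm).elim ht hs, ?_⟩
    rw [map_mul, map_mul, ← e, ← e', smul_eq_mul]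
    ring

theorem mul_mem_of_isUnit {K : Ideal S} {b u : S} (hu : IsUnit u) (h : b * u ∈ K) : b ∈ K := by
  obtain ⟨v, hv⟩ := hu.exists_right_inv
  have := K.mul_mem_right v h
  rwa [mul_assoc, hv, mul_one] at this

theorem IsLocAt.mem_map_iff [P.IsPrime] (h : IsLocAt P ψ) {K : Ideal A} {a : A} :
    ψ a ∈ K.map ψ ↔ ∃ s, s ∉ P ∧ s * a ∈ K := by
  constructor
  · intro ha
    obtain ⟨k, hk, s, hs, e⟩ := h.exists_of_mem_map ha
    obtain ⟨t, ht, e'⟩ := h.eq_zero (a * s - k) (by rw [map_sub, map_mul, e, sub_self])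
    refine ⟨t * s, fun hm => (Ideal.IsPrime.mem_or_mem ‹_› hm).elim ht hs, ?_⟩
    rw [mul_sub, sub_eq_zero] at e'
    rw [mul_assoc, mul_comm s, e']
    exact K.mul_mem_left _ hk
  · rintro ⟨s, hs, hsa⟩
    refine mul_mem_of_isUnit (h.isUnit s hs) ?_
    rw [← map_mul, mul_comm]
    exact Ideal.mem_map_of_mem _ hsa

theorem IsLocAt.map_comap (h : IsLocAt P ψ) (I : Ideal S) : (I.comap ψ).map ψ = I := by
  refine le_antisymm Ideal.map_comap_le fun b hb => ?_
  obtain ⟨a, s, hs, e⟩ := h.surj b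
  refine mul_mem_of_isUnit (h.isUnit s hs) ?_
  rw [e]
  refine Ideal.mem_map_of_mem _ ?_
  rw [Ideal.mem_comap, ← e]
  exact I.mul_mem_right _ hb

theorem IsLocAt.isUnit_iff [P.IsPrime] (h : IsLocAt P ψ) {s : A} : IsUnit (ψ s) ↔ s ∉ P := by
  refine ⟨fun hu hs => ?_, h.isUnit s⟩
  have h1 : ψ 1 ∈ P.map ψ := by
    obtain ⟨v, hv⟩ := hu.exists_right_inv
    rw [map_one, ← hv]
    exact Ideal.mul_mem_right _ _ (Ideal.mem_map_of_mem _ hs)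
  obtain ⟨t, ht, ht'⟩ := h.mem_map_iff.1 h1
  rw [mul_one] at ht'
  exact ht ht'

theorem IsLocAt.comap_maximalIdeal [P.IsPrime] [IsLocalRing S] (h : IsLocAt P ψ) :
    (maximalIdeal S).comap ψ = P := by
  ext s
  rw [Ideal.mem_comap, mem_maximalIdeal, mem_nonunits_iff, h.isUnit_iff, not_not]

theorem IsLocAt.maximalIdeal_eq [P.IsPrime] [IsLocalRing S] (h : IsLocAt P ψ) :
    maximalIdeal S = P.map ψ := by
  rw [← h.map_comap (maximalIdeal S), h.comap_maximalIdeal]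

theorem IsLocAt.regMod [P.IsPrime] (h : IsLocAt P ψ) {a : Ideal A} {x : A} (hx : RegMod a x) :
    RegMod (a.map ψ) (ψ x) := by
  intro z hz
  obtain ⟨w, s, hs, e⟩ := h.surj z
  refine mul_mem_of_isUnit (h.isUnit s hs) ?_
  have h1 := (a.map ψ).mul_mem_right (ψ s) hz
  rw [mul_assoc, e, ← map_mul, h.mem_map_iff] at h1
  rw [e, h.mem_map_iff]
  obtain ⟨t, ht, htm⟩ := h1
  refine ⟨t, ht, hx _ ?_⟩
  convert htm using 1
  ring

theorem exists_common_of_notMem [P.IsPrime] {a : Ideal A} {n : ℕ} (f : Fin n → A)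
    (h : ∀ j, ∃ s, s ∉ P ∧ s * f j ∈ a) : ∃ s, s ∉ P ∧ ∀ j, s * f j ∈ a := by
  choose s hs hsf using h
  refine ⟨∏ j, s j, fun hm => ?_, fun j => ?_⟩
  · obtain ⟨j, -, hj⟩ := (Ideal.IsPrime.prod_mem_iff (p := P)).1 hm
    exact hs j hj
  · rw [← Finset.mul_prod_erase Finset.univ s (Finset.mem_univ j)]
    have := a.mul_mem_left (∏ i ∈ Finset.univ.erase j, s i) (hsf j)
    convert this using 1
    ring

theorem IsLocAt.map_colon [P.IsPrime] [IsNoetherianRing A] (h : IsLocAt P ψ) (a K : Ideal A) :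
    (a.colon (K : Set A)).map ψ = (a.map ψ).colon (K.map ψ : Set S) := by
  apply le_antisymm
  · rw [Ideal.map_le_iff_le_comap]
    intro z hz
    rw [Ideal.mem_comap, mem_colon_ideal]
    intro w hw
    obtain ⟨k, hk, s, hs, e⟩ := h.exists_of_mem_map hw
    refine mul_mem_of_isUnit (h.isUnit s hs) ?_
    rw [mul_assoc, e, ← map_mul]
    exact Ideal.mem_map_of_mem _ (mem_colon_ideal.1 hz k hk)
  · intro z hz
    obtain ⟨w, s, hs, e⟩ := h.surj z
    refine mul_mem_of_isUnit (h.isUnit s hs) ?_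
    rw [e, h.mem_map_iff]
    obtain ⟨n, k, hk⟩ := Submodule.fg_iff_exists_fin_generating_family.1
      (IsNoetherian.noetherian K)
    obtain ⟨t, ht, htk⟩ := exists_common_of_notMem (P := P) (a := a) (fun j => w * k j) (fun j => by
      have h1 := mem_colon_ideal.1 hz (ψ (k j))
        (Ideal.mem_map_of_mem _ (hk ▸ Submodule.subset_span ⟨j, rfl⟩))
      have h2 := (a.map ψ).mul_mem_right (ψ s) h1
      rw [mul_right_comm, e, ← map_mul] at h2
      exact h.mem_map_iff.1 h2)
    refine ⟨t, ht, mem_colon_ideal.2 fun u hu => ?_⟩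
    rw [← hk] at hu
    obtain ⟨ρ, rfl⟩ := mem_span_range.1 hu
    rw [Finset.mul_sum]
    refine a.sum_mem fun j _ => ?_
    have := a.mul_mem_left (ρ j) (htk j)
    convert this using 1
    ring

end Loc

section Poly
open MvPolynomial
variable {B : Type*} [CommRing B] {σ : Type*}

theorem C_mem_map_C {a : Ideal B} {b : B} :
    (C b : MvPolynomial σ B) ∈ a.map (C : B →+* MvPolynomial σ B) ↔ b ∈ a := by
  classical
  refine ⟨fun h => ?_, Ideal.mem_map_of_mem _⟩
  simpa using mem_map_C_iff.1 h 0

theorem map_C_ne_top {a : Ideal B} (ha : a ≠ ⊤) : a.map (C : B →+* MvPolynomial σ B) ≠ ⊤ := by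
  rw [Ideal.ne_top_iff_one] at ha ⊢
  rwa [← C_1, C_mem_map_C]

theorem regMod_map_C {a : Ideal B} {x : B} (hx : RegMod a x) :
    RegMod (a.map (C : B →+* MvPolynomial σ B)) (C x) := by
  intro z hz
  rw [mem_map_C_iff] at hz ⊢
  intro d
  have := hz d
  rw [coeff_C_mul] at this
  exact hx _ this

variable [IsLocalRing B] [IsNoetherianRing B] [Finite σ]

/-- A polynomial with some unit coefficient is a nonzerodivisor modulo extended ideals. -/
theorem mem_map_C_of_mul_mem {a : Ideal B} {F G : MvPolynomial σ B}
    (hG : G ∉ (maximalIdeal B).map (C : B →+* MvPolynomial σ B))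
    (h : G * F ∈ a.map (C : B →+* MvPolynomial σ B)) :
    F ∈ a.map (C : B →+* MvPolynomial σ B) := by
  classical
  obtain ⟨n, ⟨e⟩⟩ := Finite.exists_equiv_fin σ
  let : LinearOrder σ := LinearOrder.lift' e e.injective
  let o : MonomialOrder σ := MonomialOrder.lex
  rw [mem_map_C_iff] at h hG ⊢
  push Not at hG
  let W : Ideal B := Ideal.span (Set.range fun d => coeff d F)
  let U : Ideal B := a ⊔ maximalIdeal B • W
  have hFW : ∀ d, coeff d F ∈ W := fun d => Ideal.subset_span ⟨d, rfl⟩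
  have key : ∀ d, coeff d F ∈ U := by
    by_contra hcon
    push Not at hcon
    obtain ⟨d0, hd0⟩ := hcon
    obtain ⟨d, hd, hdmax⟩ := (F.support.filter fun d => coeff d F ∉ U).exists_max_image o.toSyn
      ⟨d0, by
        rw [Finset.mem_filter, mem_support_iff]
        exact ⟨fun h0 => hd0 (h0 ▸ U.zero_mem), hd0⟩⟩
    obtain ⟨e0, he0⟩ := hG
    obtain ⟨e, he, hemax⟩ :=
      (G.support.filter fun d => coeff d G ∉ maximalIdeal B).exists_max_image o.toSyn
      ⟨e0, by
        rw [Finset.mem_filter, mem_support_iff]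
        exact ⟨fun h0 => he0 (h0 ▸ Ideal.zero_mem _), he0⟩⟩
    rw [Finset.mem_filter] at hd he
    have h1 : coeff (e + d) (G * F) ∈ U := (le_sup_left : a ≤ U) (h (e + d))
    rw [coeff_mul, ← Finset.add_sum_erase _ _
      (show (e, d) ∈ Finset.HasAntidiagonal.antidiagonal (e + d) by simp)] at h1
    have h2 : ∑ p ∈ (Finset.HasAntidiagonal.antidiagonal (e + d)).erase (e, d), coeff p.1 G * coeff p.2 F ∈ U := by
      refine U.sum_mem ?_
      rintro ⟨u, v⟩ huv
      rw [Finset.mem_erase, Finset.HasAntidiagonal.mem_antidiagonal] at huv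
      obtain ⟨hne, huv⟩ := huv
      simp only at huv ⊢
      by_cases hu : coeff u G ∈ maximalIdeal B
      · exact (le_sup_right : _ ≤ U) (Submodule.smul_mem_smul hu (hFW v))
      · by_cases hv : coeff v F ∈ U
        · exact U.mul_mem_left _ hv
        · exfalso
          have hu1 := hemax u (by
            rw [Finset.mem_filter, mem_support_iff]
            exact ⟨fun h0 => hu (h0 ▸ Ideal.zero_mem _), hu⟩)
          have hv1 := hdmax v (by
            rw [Finset.mem_filter, mem_support_iff]
            exact ⟨fun h0 => hv (h0 ▸ U.zero_mem), hv⟩)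
          have hsum : o.toSyn u + o.toSyn v = o.toSyn e + o.toSyn d := by
            rw [← map_add, huv, map_add]
          have hue : o.toSyn u = o.toSyn e := by
            refine le_antisymm hu1 ?_
            by_contra hlt
            exact (add_lt_add_of_lt_of_le (not_le.1 hlt) hv1).ne hsum
          have hvd : o.toSyn v = o.toSyn d := by
            rw [hue] at hsum
            exact add_left_cancel hsum
          exact hne (Prod.ext (o.toSyn.injective hue) (o.toSyn.injective hvd))
    have h3 := (U.add_mem_iff_left h2).1 h1
    apply hd.2
    rw [mul_comm] at h3
    exact mul_mem_of_isUnit (notMem_maximalIdeal.1 he.2) h3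
  have hWa : W ≤ a := Submodule.le_of_le_smul_of_le_jacobson_bot (I := maximalIdeal B)
    (IsNoetherian.noetherian W) (IsLocalRing.jacobson_eq_maximalIdeal _ bot_ne_top).ge (by
      rw [Ideal.span_le]
      rintro _ ⟨d, rfl⟩
      exact key d)
  exact fun d => hWa (hFW d)

instance isPrime_map_C : ((maximalIdeal B).map (C : B →+* MvPolynomial σ B)).IsPrime := by
  refine ⟨map_C_ne_top (maximalIdeal.isMaximal B).ne_top, fun {F G} h => ?_⟩
  by_contra hcon
  push Not at hcon
  exact hcon.2 (mem_map_C_of_mul_mem hcon.1 h)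

end Poly

section Univ
open MvPolynomial
variable {B : Type*} [CommRing B] [IsLocalRing B] [IsNoetherianRing B]
  {σ : Type*} [Finite σ] {S : Type*} [CommRing S] {ψ : MvPolynomial σ B →+* S}
  (hψ : IsLocAt ((maximalIdeal B).map (C : B →+* MvPolynomial σ B)) ψ)
include hψ

theorem IsLocAt.mem_map_comp_iff {a : Ideal B} {F : MvPolynomial σ B} :
    ψ F ∈ a.map (ψ.comp C) ↔ F ∈ a.map (C : B →+* MvPolynomial σ B) := by
  rw [← Ideal.map_map, hψ.mem_map_iff]
  constructor
  · rintro ⟨s, hs, h⟩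
    exact mem_map_C_of_mul_mem hs h
  · exact fun h => ⟨1, fun h1 => Ideal.IsPrime.ne_top isPrime_map_C ((Ideal.eq_top_iff_one _).2 h1),
      by simpa using h⟩

theorem IsLocAt.apply_C_mem_iff {a : Ideal B} {b : B} :
    ψ (C b) ∈ a.map (ψ.comp C) ↔ b ∈ a := by
  rw [hψ.mem_map_comp_iff, C_mem_map_C]

theorem IsLocAt.map_comp_ne_top {a : Ideal B} (ha : a ≠ ⊤) : a.map (ψ.comp C) ≠ ⊤ := by
  rw [Ideal.ne_top_iff_one] at ha ⊢
  rwa [← map_one (ψ.comp C), RingHom.comp_apply, hψ.apply_C_mem_iff]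

theorem IsLocAt.regMod_comp {a : Ideal B} {x : B} (hx : RegMod a x) :
    RegMod (a.map (ψ.comp C)) (ψ.comp C x) := by
  rw [← Ideal.map_map]
  exact hψ.regMod (regMod_map_C hx)

theorem IsLocAt.regChain {Q : Ideal B} {Q' : Ideal S} (hQ : Q.map (ψ.comp C) ≤ Q')
    {F : Ideal B → Prop} {F' : Ideal S → Prop} (hF : ∀ a, F a → F' (a.map (ψ.comp C)))
    {r : ℕ} {a : Ideal B} (h : RegChain Q F r a) : RegChain Q' F' r (a.map (ψ.comp C)) := by
  induction r generalizing a with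
  | zero => exact hF a h
  | succ r ih =>
    obtain ⟨x, hxQ, hx, h⟩ := h
    refine ⟨ψ.comp C x, hQ (Ideal.mem_map_of_mem _ hxQ), hψ.regMod_comp hx, ?_⟩
    have := ih h
    rwa [Ideal.map_sup, Ideal.map_span, Set.image_singleton] at this

theorem IsLocAt.maxReg {g : ℕ} {L : Ideal B} (h : MaxReg g L) : MaxReg g (L.map (ψ.comp C)) := by
  have := hψ.regChain (Q := L) le_rfl (F := fun a => ∃ s, s ∉ a ∧ ∀ q ∈ L, q * s ∈ a)
    (F' := fun a => ∃ s, s ∉ a ∧ ∀ q ∈ L.map (ψ.comp C), q * s ∈ a) (fun a => by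
      rintro ⟨s, hs, hL⟩
      refine ⟨ψ (C s), fun h => hs (hψ.apply_C_mem_iff.1 h), fun q hq => ?_⟩
      have hle : L.map (ψ.comp C) ≤ (a.map (ψ.comp C)).colon {ψ (C s)} := by
        rw [Ideal.map_le_iff_le_comap]
        intro k hk
        rw [Ideal.mem_comap, Submodule.mem_colon_singleton, smul_eq_mul, RingHom.comp_apply,
          ← map_mul, ← C_mul, hψ.apply_C_mem_iff]
        exact hL k hk
      exact Submodule.mem_colon_singleton.1 (hle hq)) h
  rwa [Ideal.map_bot] at this

variable [IsLocalRing S]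

theorem IsLocAt.map_maximalIdeal : (maximalIdeal B).map (ψ.comp C) = maximalIdeal S := by
  rw [hψ.maximalIdeal_eq, Ideal.map_map]

theorem IsLocAt.dep {r : ℕ} {a : Ideal B} (h : Dep r a) : Dep r (a.map (ψ.comp C)) :=
  hψ.regChain hψ.map_maximalIdeal.le (fun _ _ => trivial) h

theorem IsLocAt.artinGor {a : Ideal B} (h : ArtinGor a) : ArtinGor (a.map (ψ.comp C)) := by
  obtain ⟨⟨n, hn⟩, s, hs, hms, hu⟩ := h
  refine ⟨⟨n, ?_⟩, ψ (C s), fun h => hs (hψ.apply_C_mem_iff.1 h), fun q hq => ?_, fun z hz => ?_⟩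
  · rw [← hψ.map_maximalIdeal, ← Ideal.map_pow]
    exact Ideal.map_mono hn
  · have hle : (maximalIdeal B).map (ψ.comp C) ≤ (a.map (ψ.comp C)).colon {ψ (C s)} := by
      rw [Ideal.map_le_iff_le_comap]
      intro k hk
      rw [Ideal.mem_comap, Submodule.mem_colon_singleton, smul_eq_mul, RingHom.comp_apply,
        ← map_mul, ← C_mul, hψ.apply_C_mem_iff]
      exact hms k hk
    rw [← hψ.map_maximalIdeal] at hq
    exact Submodule.mem_colon_singleton.1 (hle hq)
  · obtain ⟨F, t, ht, e⟩ := hψ.surj z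
    have hF : ∀ d, ∃ c, coeff d F - c * s ∈ a := by
      intro d
      refine hu _ fun m hm => ?_
      have h1 := Ideal.mul_mem_right (ψ t) _ (hz (ψ (C m)) (by
        rw [← hψ.map_maximalIdeal]
        exact Ideal.mem_map_of_mem (ψ.comp C) hm))
      rw [mul_assoc, e, ← map_mul, hψ.mem_map_comp_iff, mem_map_C_iff] at h1
      simpa [coeff_C_mul] using h1 d
    choose c hc using hF
    let G : MvPolynomial σ B := ∑ d ∈ F.support, monomial d (c d)
    have hG : F - G * C s ∈ a.map (C : B →+* MvPolynomial σ B) := by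
      have hFG : F - G * C s = ∑ d ∈ F.support, monomial d (coeff d F - c d * s) := by
        conv_lhs => rw [F.as_sum]
        simp only [G, Finset.sum_mul, ← Finset.sum_sub_distrib, monomial_mul, C_apply, add_zero,
          map_sub]
      rw [hFG]
      refine Ideal.sum_mem _ fun d _ => ?_
      rw [← mul_one (coeff d F - c d * s), ← C_mul_monomial]
      exact Ideal.mul_mem_right _ _ (Ideal.mem_map_of_mem _ (hc d))
    obtain ⟨v, hv⟩ := (hψ.isUnit t ht).exists_right_inv
    refine ⟨ψ G * v, ?_⟩
    have h2 := Ideal.mul_mem_right v _ ((hψ.mem_map_comp_iff).2 hG)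
    rw [map_sub, map_mul, ← e] at h2
    have h3 : (z * ψ t - ψ G * ψ (C s)) * v = z * (ψ t * v) - ψ G * v * ψ (C s) := by ring
    rwa [h3, hv, mul_one] at h2

theorem IsLocAt.gor {r : ℕ} {a : Ideal B} (h : Gor r a) : Gor r (a.map (ψ.comp C)) :=
  hψ.regChain hψ.map_maximalIdeal.le (fun _ h => hψ.artinGor h) h

end Univ

section Specialize
variable {T R : Type*} [CommRing T] [CommRing R] {π : T →+* R}

theorem comap_map_of_ker (hπ : Function.Surjective π) {xs : List T}
    (hxs : (⊥ : Ideal R).comap π = Ideal.ofList xs) (K : Ideal T) :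
    (K.map π).comap π = K ⊔ Ideal.ofList xs := by
  rw [Ideal.comap_map_of_surjective π hπ, hxs]

theorem map_colon_of_surjective (hπ : Function.Surjective π) {a K : Ideal R} {J : Ideal T}
    (hJ : (a.comap π).colon (K.comap π : Set T) = J) : J.map π = a.colon (K : Set R) := by
  subst hJ
  apply le_antisymm
  · rw [Ideal.map_le_iff_le_comap]
    intro z hz
    rw [Ideal.mem_comap, mem_colon_ideal]
    intro k hk
    obtain ⟨k, rfl⟩ := hπ k
    rw [← map_mul]
    exact mem_colon_ideal.1 hz k hk
  · intro z hz
    obtain ⟨z, rfl⟩ := hπ z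
    refine Ideal.mem_map_of_mem _ (mem_colon_ideal.2 fun k hk => ?_)
    rw [Ideal.mem_comap, map_mul]
    exact mem_colon_ideal.1 hz _ hk

theorem map_ofList (l : List T) : (Ideal.ofList l).map π = Ideal.ofList (l.map π) := by
  induction l with
  | nil => simp
  | cons x l ih => simp [Ideal.ofList_cons, Ideal.map_sup, ih, Ideal.map_span]

variable [IsLocalRing T] [IsNoetherianRing T] [IsLocalRing R] [IsNoetherianRing R]

theorem mem_maximalIdeal_of_ker (hπ : Function.Surjective π) {xs : List T}
    (hxs : (⊥ : Ideal R).comap π = Ideal.ofList xs) : ∀ x ∈ xs, x ∈ maximalIdeal T := by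
  intro x hx
  rw [← comap_maximalIdeal_of_surjective hπ]
  refine Ideal.comap_mono bot_le ?_
  rw [hxs]
  exact Ideal.subset_span hx

theorem map_ne_top_of_ker (hπ : Function.Surjective π) {K : Ideal T} (hK : K ≠ ⊤) :
    K.map π ≠ ⊤ := by
  refine ne_top_of_le_ne_top (maximalIdeal.isMaximal R).ne_top (Ideal.map_le_iff_le_comap.2 ?_)
  rw [comap_maximalIdeal_of_surjective hπ]
  exact le_maximalIdeal hK

/-- Links lift along reduction modulo a regular sequence. -/
theorem lift_link (hπ : Function.Surjective π) {xs : List T}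
    (hxs : (⊥ : Ideal R).comap π = Ideal.ofList xs) (hx : RegSeq ⊥ xs) {c : List T} {r : ℕ}
    (hG : Gor (xs.length + (c.length + r)) (⊥ : Ideal T)) {K : Ideal T} (hxK : RegSeq K xs)
    (hD : Dep (xs.length + r) K) (hcm : ∀ x ∈ c, x ∈ maximalIdeal T) (hcK : ∀ x ∈ c, x ∈ K)
    (hcR : RegSeq (⊥ : Ideal R) (c.map π)) :
    RegSeq ⊥ c ∧ RegSeq ((Ideal.ofList c).colon (K : Set T)) xs ∧
      Dep (xs.length + r) ((Ideal.ofList c).colon (K : Set T)) ∧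
      ((Ideal.ofList c).colon (K : Set T)).map π =
        (Ideal.ofList (c.map π)).colon (K.map π : Set R) := by
  have hxm := mem_maximalIdeal_of_ker hπ hxs
  have h1 : RegSeq ⊥ (xs ++ c) := by
    refine regSeq_append.2 ⟨hx, ?_⟩
    rw [bot_sup_eq, ← hxs, regSeq_comap hπ]
    exact hcR
  obtain ⟨hc, hcx⟩ := regSeq_append.1 (h1.perm List.perm_append_comm (fun x h =>
    (List.mem_append.1 h).elim (hxm x) (hcm x)))
  rw [bot_sup_eq] at hcx
  have hG' : Gor (xs.length + r) (Ideal.ofList c) := by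
    have : xs.length + (c.length + r) = c.length + (xs.length + r) := by omega
    rw [this] at hG
    simpa using hG.exchange_list c hcm hc
  have hle : Ideal.ofList c ≤ K := Ideal.span_le.2 hcK
  obtain ⟨e, hr⟩ := colon_sup_ofList r xs hle hxm hG' hD hcx hxK
  refine ⟨hc, hr, (duality _ hle hG' hD).2.2, ?_⟩
  have hk : (⊥ : Ideal R).comap π ≤ (Ideal.ofList c).colon (K : Set T) ⊔ Ideal.ofList xs :=
    hxs ▸ le_sup_right
  have h2 := map_colon_of_surjective hπ (a := Ideal.ofList (c.map π)) (K := K.map π)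
    (J := (Ideal.ofList c).colon (K : Set T) ⊔ Ideal.ofList xs) (by
      rw [comap_map_of_ker hπ hxs, ← map_ofList, comap_map_of_ker hπ hxs, e])
  rw [← h2, Ideal.map_sup, ← hxs, Ideal.map_comap_of_surjective π hπ, sup_bot_eq]

end Specialize

section LocAt
variable {A S : Type*} [CommRing A] [CommRing S] {P : Ideal A} [P.IsPrime] {ψ : A →+* S}
  (hψ : IsLocAt P ψ)
include hψ

theorem IsLocAt.regSeq_map {a : Ideal A} {l : List A} (h : RegSeq a l) :
    RegSeq (a.map ψ) (l.map ψ) := by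
  induction l generalizing a with
  | nil => trivial
  | cons x l ih =>
    refine ⟨hψ.regMod h.1, ?_⟩
    have := ih h.2
    rwa [Ideal.map_sup, Ideal.map_span, Set.image_singleton] at this

end LocAt

section Eval
open MvPolynomial
variable {R : Type*} [CommRing R] {σ : Type*}

theorem sub_bind_mem {S : Set σ} (lam : σ → R) (f : MvPolynomial σ R →ₐ[R] MvPolynomial σ R)
    (hS : ∀ i ∈ S, f (X i) = C (lam i)) (hS' : ∀ i ∉ S, f (X i) = X i) (z : MvPolynomial σ R) :
    z - f z ∈ Ideal.span ((fun i => X i - C (lam i) : σ → MvPolynomial σ R) '' S) := by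
  rw [← Ideal.Quotient.eq]
  have : (Ideal.Quotient.mkₐ R (Ideal.span ((fun i => X i - C (lam i)) '' S))) =
      (Ideal.Quotient.mkₐ R (Ideal.span ((fun i => X i - C (lam i)) '' S))).comp f := by
    apply MvPolynomial.algHom_ext
    intro i
    by_cases hi : i ∈ S
    · simp only [AlgHom.comp_apply, hS i hi]
      exact Ideal.Quotient.eq.2 (Ideal.subset_span ⟨i, hi, rfl⟩)
    · simp [hS' i hi]
  exact DFunLike.congr_fun this z

theorem ker_eval (lam : σ → R) : (⊥ : Ideal R).comap (eval lam) =
    Ideal.span (Set.range (fun i => X i - C (lam i) : σ → MvPolynomial σ R)) := by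
  apply le_antisymm
  · intro z hz
    rw [Ideal.mem_comap, Ideal.mem_bot] at hz
    have := sub_bind_mem (S := Set.univ) lam (aeval fun i => C (lam i)) (by simp) (by simp) z
    rw [Set.image_univ] at this
    have h0 : (aeval (fun i => (C (lam i) : MvPolynomial σ R))) z = C (eval lam z) := by
      have : aeval (R := R) (fun i => (C (lam i) : MvPolynomial σ R)) =
          (Algebra.ofId R (MvPolynomial σ R)).comp (aeval lam) := by
        ext; simp [Algebra.ofId_apply]
      rw [this]; simp [Algebra.ofId_apply, aeval_eq_eval]
    rwa [h0, hz, map_zero, sub_zero] at this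
  · rw [Ideal.span_le]
    rintro _ ⟨i, rfl⟩
    simp

theorem map_C_map_eval (lam : σ → R) (a : Ideal R) :
    (a.map (C : R →+* MvPolynomial σ R)).map (eval lam) = a := by
  rw [Ideal.map_map]
  have : (eval lam).comp (C : R →+* MvPolynomial σ R) = RingHom.id R := by ext; simp
  rw [this, Ideal.map_id]

variable [IsLocalRing R] [IsNoetherianRing R] [Finite σ]

theorem X_sub_C_notMem (i : σ) (c : R) :
    (X i - C c : MvPolynomial σ R) ∉ (maximalIdeal R).map (C : R →+* MvPolynomial σ R) := by
  classical
  intro h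
  have := mem_map_C_iff.1 h (Finsupp.single i 1)
  have h0 : (0 : σ →₀ ℕ) ≠ Finsupp.single i 1 := fun h => by
    simpa using DFunLike.congr_fun h i
  rw [coeff_sub, coeff_C, if_neg h0, sub_zero, coeff_X, if_pos rfl] at this
  exact (maximalIdeal.isMaximal R).ne_top ((Ideal.eq_top_iff_one _).2 this)

theorem regSeq_X_sub_C (lam : σ → R) (a : Ideal R) (l : List σ) (hl : l.Nodup) :
    RegSeq (a.map (C : R →+* MvPolynomial σ R)) (l.map fun i => X i - C (lam i)) := by
  classical
  induction l using List.reverseRecOn with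
  | nil => trivial
  | append_singleton l i ih =>
    rw [List.nodup_append'] at hl
    rw [List.map_append, regSeq_append]
    refine ⟨ih hl.1, ?_, trivial⟩
    have hi : i ∉ l := fun h => hl.2.2 h (by simp)
    let f : MvPolynomial σ R →ₐ[R] MvPolynomial σ R :=
      aeval fun j => if j ∈ l then C (lam j) else X j
    have hsub := sub_bind_mem (S := {j | j ∈ l}) lam f (fun j hj => by simp [f, show j ∈ l from hj])
      (fun j hj => by simp [f, show j ∉ l from hj])
    have himg : Ideal.span ((fun j => X j - C (lam j) : σ → MvPolynomial σ R) '' {j | j ∈ l}) =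
        Ideal.ofList (l.map fun j => X j - C (lam j)) := by
      congr 1
      ext z; simp
    rw [himg] at hsub
    have hle : a.map (C : R →+* MvPolynomial σ R) ⊔
        Ideal.ofList (l.map fun j => X j - C (lam j)) ≤ (a.map C).comap f.toRingHom := by
      rw [sup_le_iff]
      constructor
      · rw [Ideal.map_le_iff_le_comap]
        intro b hb
        change f (C b) ∈ a.map C
        simpa [f] using Ideal.mem_map_of_mem C hb
      · refine Ideal.span_le.2 fun z hz => ?_
        obtain ⟨j, hj, rfl⟩ := List.mem_map.1 hz
        change f _ ∈ a.map C
        simp [f, hj]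
    intro z hz
    have h1 : f ((X i - C (lam i)) * z) ∈ a.map C := hle hz
    rw [map_mul] at h1
    have h2 : f (X i - C (lam i)) = X i - C (lam i) := by simp [f, hi]
    rw [h2] at h1
    have h3 := mem_map_C_of_mul_mem (X_sub_C_notMem i (lam i)) h1
    have h4 := Ideal.add_mem _ (Ideal.mem_sup_right (hsub z)) (Ideal.mem_sup_left h3)
    rwa [sub_add_cancel] at h4

end Eval

section Setup
open MvPolynomial
variable {R : Type} [CommRing R] [IsLocalRing R] [IsNoetherianRing R] {σ : Type} [Finite σ]
  {B : Type} [CommRing B] [IsLocalRing B] {ψ : MvPolynomial σ R →+* B}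

/-- The local ring of `R[X]` at the point `lam`, as an intermediate ring. -/
theorem exists_local (hψ : IsLocAt ((maximalIdeal R).map (C : R →+* MvPolynomial σ R)) ψ)
    (lam : σ → R) : ∃ (T : Type) (_ : CommRing T) (_ : IsLocalRing T) (_ : IsNoetherianRing T)
      (τ : MvPolynomial σ R →+* T) (π : T →+* R) (ι : T →+* B),
      IsLocAt ((maximalIdeal R).comap (eval lam)) τ ∧ Function.Surjective π ∧
      π.comp τ = eval lam ∧ ι.comp τ = ψ ∧ IsLocAt ((maximalIdeal B).comap ι) ι := by
  let Q := (maximalIdeal R).comap (eval lam)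
  have hQ : Q.IsPrime := Ideal.IsPrime.comap _
  have hle : (maximalIdeal R).map (C : R →+* MvPolynomial σ R) ≤ Q := by
    rw [Ideal.map_le_iff_le_comap]
    intro b hb
    simpa [Q] using hb
  have h1 : ∀ y : Q.primeCompl, IsUnit (eval lam y.1) := fun y => by
    by_contra h
    exact y.2 ((mem_maximalIdeal _).2 h)
  have h2 : ∀ y : Q.primeCompl, IsUnit (ψ y.1) := fun y => hψ.isUnit _ fun h => y.2 (hle h)
  have hτ : IsLocAt Q (algebraMap (MvPolynomial σ R) (Localization.AtPrime Q)) := isLocAt_algebraMap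
  have hπτ := IsLocalization.lift_comp (S := Localization.AtPrime Q) h1
  have hιτ := IsLocalization.lift_comp (S := Localization.AtPrime Q) h2
  refine ⟨Localization.AtPrime Q, inferInstance, inferInstance, hτ.isNoetherianRing,
    algebraMap _ _, IsLocalization.lift h1, IsLocalization.lift h2, hτ, ?_, hπτ, hιτ, ?_⟩
  · intro b
    refine ⟨algebraMap (MvPolynomial σ R) _ (C b), ?_⟩
    rw [IsLocalization.lift_eq]
    simp
  · have hι := RingHom.congr_fun hιτ
    simp only [RingHom.comp_apply] at hι
    refine ⟨fun s hs => ?_, fun b => ?_, fun a ha => ?_⟩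
    · by_contra h
      exact hs ((mem_maximalIdeal _).2 h)
    · obtain ⟨F, s, hs, e⟩ := hψ.surj b
      refine ⟨algebraMap (MvPolynomial σ R) _ F, algebraMap (MvPolynomial σ R) _ s, fun h => ?_, by rw [hι, hι, e]⟩
      rw [Ideal.mem_comap, hι] at h
      exact h (hψ.isUnit s hs)
    · obtain ⟨F, s, hs, e⟩ := hτ.surj a
      have h3 : ψ F = 0 := by
        rw [← hι, ← e, map_mul, ha, zero_mul]
      obtain ⟨t, ht, h4⟩ := hψ.eq_zero F h3
      refine ⟨algebraMap (MvPolynomial σ R) _ t, fun h => ?_, ?_⟩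
      · rw [Ideal.mem_comap, hι] at h
        exact h (hψ.isUnit t ht)
      · have h5 : algebraMap (MvPolynomial σ R) (Localization.AtPrime Q) t * a *
            algebraMap (MvPolynomial σ R) (Localization.AtPrime Q) s = 0 := by
          rw [mul_assoc, e, ← map_mul, h4, map_zero]
        exact (hτ.isUnit s hs).mul_left_eq_zero.1 h5

end Setup

section Weak
variable {R : Type*} [CommRing R]

/-- A linkage step in which links are allowed to become the unit ideal. -/
def WStep (g : ℕ) (J J' : Ideal R) : Prop :=
  (J = ⊤ ∧ J' = ⊤) ∨ (J ≠ ⊤ ∧ ∃ c : List R, c.length = g ∧ RegSeq ⊥ c ∧ (∀ x ∈ c, x ∈ J) ∧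
    J' = (Ideal.ofList c).colon (J : Set R))

/-- A sequence of `n` linkage steps in which links are allowed to become the unit ideal. -/
def WChain (g : ℕ) : ℕ → Ideal R → Ideal R → Prop
  | 0, J, J' => J = J'
  | n + 1, J, J' => ∃ K, WStep g J K ∧ WChain g n K J'

theorem wChain_top (g n : ℕ) : WChain g n (⊤ : Ideal R) ⊤ := by
  induction n with
  | zero => rfl
  | succ n ih => exact ⟨⊤, Or.inl ⟨rfl, rfl⟩, ih⟩

end Weak

section Direct
variable {R : Type} [CommRing R] [IsLocalRing R] [IsNoetherianRing R]

theorem isDirectlyLinked_iff {I J : Ideal R} : IsDirectlyLinked R I J ↔ I ≠ ⊤ ∧ J ≠ ⊤ ∧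
    ∃ c : List R, RegSeq ⊥ c ∧ (∀ x ∈ c, x ∈ I) ∧ (∀ x ∈ c, x ∈ J) ∧
      (Ideal.ofList c).colon (J : Set R) = I ∧ (Ideal.ofList c).colon (I : Set R) = J := by
  constructor
  · rintro ⟨hI, hJ, _, hc, hle, h1, h2⟩
    obtain ⟨c, hcm, hr, rfl⟩ := isCompleteIntersectionIdeal_iff.1 hc
    exact ⟨hI, hJ, c, hr, fun x hx => (hle (Ideal.subset_span hx)).1,
      fun x hx => (hle (Ideal.subset_span hx)).2, h1, h2⟩
  · rintro ⟨hI, hJ, c, hr, hcI, hcJ, h1, h2⟩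
    exact ⟨hI, hJ, _, isCompleteIntersectionIdeal_iff.2
      ⟨c, fun x hx => le_maximalIdeal hI (hcI x hx), hr, rfl⟩,
      le_inf (Ideal.span_le.2 hcI) (Ideal.span_le.2 hcJ), h1, h2⟩

theorem exists_notMem_colon {c : List R} {I J : Ideal R}
    (h1 : (Ideal.ofList c).colon (J : Set R) = I) (h2 : (Ideal.ofList c).colon (I : Set R) = J)
    (hJ : J ≠ ⊤) :
    ∃ s, s ∉ Ideal.ofList c ∧ ∀ q ∈ J, q * s ∈ Ideal.ofList c := by
  have : ∃ s ∈ I, s ∉ Ideal.ofList c := by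
    by_contra! hcon
    apply hJ
    rw [← h2, Ideal.eq_top_iff_one, mem_colon_ideal]
    intro k hk
    rw [one_mul]
    exact hcon k hk
  obtain ⟨s, hs, hsc⟩ := this
  refine ⟨s, hsc, fun q hq => ?_⟩
  rw [← h1] at hs
  rw [mul_comm]
  exact mem_colon_ideal.1 hs q hq

/-- Directly linked ideals have the same grade. -/
theorem link_maxReg {g : ℕ} {I J : Ideal R} (hI : I ≠ ⊤) (hJ : J ≠ ⊤) {c : List R}
    (hr : RegSeq ⊥ c) (hcI : ∀ x ∈ c, x ∈ I) (hcJ : ∀ x ∈ c, x ∈ J)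
    (h1 : (Ideal.ofList c).colon (J : Set R) = I)
    (h2 : (Ideal.ofList c).colon (I : Set R) = J) (hg : MaxReg g I) :
    c.length = g ∧ MaxReg g J := by
  obtain ⟨s, hs, hsI⟩ := exists_notMem_colon h2 h1 hI
  obtain ⟨t, ht, htJ⟩ := exists_notMem_colon h1 h2 hJ
  have e := (MaxReg.of_exists hcI hr hs hsI).unique hg hI
  subst e
  exact ⟨rfl, MaxReg.of_exists hcJ hr ht htJ⟩

theorem wChain_of_linkedInSteps {g n : ℕ} {I J : Ideal R} (hg : I ≠ ⊤ → MaxReg g I)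
    (h : LinkedInSteps R n I J) : WChain g n I J := by
  induction n generalizing I with
  | zero => exact h
  | succ n ih =>
    obtain ⟨K, hIK, hK⟩ := h
    obtain ⟨hI, hKt, c, hr, hcI, hcK, h1, h2⟩ := isDirectlyLinked_iff.1 hIK
    obtain ⟨e, hgK⟩ := link_maxReg hI hKt hr hcI hcK h1 h2 (hg hI)
    exact ⟨K, Or.inr ⟨hI, c, e, hr, hcI, h2.symm⟩, ih (fun _ => hgK) hK⟩

end Direct

section LiftDim
variable {T R : Type*} [CommRing T] [CommRing R] {π : T →+* R}
variable [IsLocalRing T] [IsNoetherianRing T] [IsLocalRing R] [IsNoetherianRing R]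

theorem Dep.lift (hπ : Function.Surjective π) {xs : List T}
    (hxs : (⊥ : Ideal R).comap π = Ideal.ofList xs) {K : Ideal T} (hK : RegSeq K xs) {r : ℕ}
    (h : Dep r (K.map π)) : Dep (xs.length + r) K := by
  refine RegChain.of_list r xs K (mem_maximalIdeal_of_ker hπ hxs) hK ?_
  rw [← comap_map_of_ker hπ hxs]
  exact h.comap hπ

theorem Gor.lift (hπ : Function.Surjective π) {xs : List T}
    (hxs : (⊥ : Ideal R).comap π = Ideal.ofList xs) {K : Ideal T} (hK : RegSeq K xs) {r : ℕ}
    (h : Gor r (K.map π)) : Gor (xs.length + r) K := by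
  refine RegChain.of_list r xs K (mem_maximalIdeal_of_ker hπ hxs) hK ?_
  rw [← comap_map_of_ker hπ hxs]
  exact h.comap hπ

end LiftDim

section Point
open MvPolynomial
variable {R : Type} [CommRing R] [IsLocalRing R] [IsNoetherianRing R] {σ : Type} [Finite σ]
  {B : Type} [CommRing B] [IsLocalRing B] [IsNoetherianRing B] {ψ : MvPolynomial σ R →+* B}
  {T : Type} [CommRing T] [IsLocalRing T] [IsNoetherianRing T]
  {lam : σ → R} {τ : MvPolynomial σ R →+* T} {π : T →+* R} {ι : T →+* B}

theorem ker_of_isLocAt (hτ : IsLocAt ((maximalIdeal R).comap (eval lam)) τ)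
    (hπτ : π.comp τ = eval lam) {l : List σ} (hl : ∀ i, i ∈ l) :
    (⊥ : Ideal R).comap π = Ideal.ofList (l.map fun i => τ (X i - C (lam i))) := by
  have hp := RingHom.congr_fun hπτ
  simp only [RingHom.comp_apply] at hp
  apply le_antisymm
  · intro z hz
    obtain ⟨F, u, hu, e⟩ := hτ.surj z
    refine mul_mem_of_isUnit (hτ.isUnit u hu) ?_
    have h1 : F ∈ (⊥ : Ideal R).comap (eval lam) := by
      rw [Ideal.mem_comap, Ideal.mem_bot] at hz ⊢
      rw [← hp, ← e, map_mul, hz, zero_mul]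
    rw [ker_eval] at h1
    rw [e]
    have h2 := Ideal.mem_map_of_mem τ h1
    refine (Ideal.map_le_iff_le_comap.2 (Ideal.span_le.2 ?_)) h2
    rintro _ ⟨i, rfl⟩
    exact Ideal.subset_span (List.mem_map.2 ⟨i, hl i, rfl⟩)
  · refine Ideal.span_le.2 fun z hz => ?_
    obtain ⟨i, -, rfl⟩ := List.mem_map.1 hz
    change π (τ _) ∈ (⊥ : Ideal R)
    rw [hp]
    simp

theorem map_comp_C_map (hπτ : π.comp τ = eval lam) (I : Ideal R) :
    (I.map (τ.comp C)).map π = I := by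
  rw [Ideal.map_map, ← RingHom.comp_assoc, hπτ, ← Ideal.map_map, map_C_map_eval]

theorem regSeq_map_comp_C (hτ : IsLocAt ((maximalIdeal R).comap (eval lam)) τ) (a : Ideal R)
    {l : List σ} (hl : l.Nodup) :
    RegSeq (a.map (τ.comp C)) (l.map fun i => τ (X i - C (lam i))) := by
  have := hτ.regSeq_map (regSeq_X_sub_C lam a l hl)
  rw [Ideal.map_map, List.map_map] at this
  exact this

variable (hψ : IsLocAt ((maximalIdeal R).map (C : R →+* MvPolynomial σ R)) ψ)
  (hτ : IsLocAt ((maximalIdeal R).comap (eval lam)) τ) (hπ : Function.Surjective π)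
  (hπτ : π.comp τ = eval lam) (hιτ : ι.comp τ = ψ) (hι : IsLocAt ((maximalIdeal B).comap ι) ι)
include hψ hτ hπ hπτ hιτ hι

theorem map_le_of_map_le {K : Ideal T} {D : Ideal R} (h : K.map ι ≤ D.map (ψ.comp C)) :
    K.map π ≤ D := by
  have hp := RingHom.congr_fun hπτ
  have hi := RingHom.congr_fun hιτ
  simp only [RingHom.comp_apply] at hp hi
  rw [Ideal.map_le_iff_le_comap]
  intro z hz
  obtain ⟨F, u, hu, e⟩ := hτ.surj z
  have h1 : ψ F ∈ D.map (ψ.comp C) := by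
    rw [← hi, ← e, map_mul]
    exact Ideal.mul_mem_right _ _ (h (Ideal.mem_map_of_mem ι hz))
  rw [hψ.mem_map_comp_iff] at h1
  have h2 := Ideal.mem_map_of_mem (eval lam) h1
  rw [map_C_map_eval, ← hp, ← e, map_mul] at h2
  exact mul_mem_of_isUnit (K := D) ((hτ.isUnit u hu).map π) h2

/-- Linkage chains in the special fibre lift to the generic fibre. -/
theorem exists_wChain {xs : List T} (hxs : (⊥ : Ideal R).comap π = Ideal.ofList xs)
    (hx : RegSeq ⊥ xs) {g r n : ℕ} (hG : Gor (xs.length + (g + r)) (⊥ : Ideal T))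
    {K : Ideal T} (hxK : RegSeq K xs) (hD : Dep (xs.length + r) K) {J : Ideal R}
    (h : WChain g n (K.map π) J) :
    ∃ J', WChain g n (K.map ι) J' ∧ ∀ D : Ideal R, D ≠ ⊤ → J' ≤ D.map (ψ.comp C) → J ≤ D := by
  have hprime : ((maximalIdeal B).comap ι).IsPrime := Ideal.IsPrime.comap _
  induction n generalizing K with
  | zero =>
    refine ⟨_, rfl, fun D _ hle => ?_⟩
    obtain rfl : K.map π = J := h
    exact map_le_of_map_le hψ hτ hπ hπτ hιτ hι hle
  | succ n ih =>
    by_cases hKι : K.map ι = ⊤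
    · refine ⟨⊤, by rw [hKι]; exact wChain_top g (n + 1), fun D hD hle => ?_⟩
      exact absurd (top_le_iff.1 hle) (hψ.map_comp_ne_top hD)
    have hKt : K ≠ ⊤ := fun h => hKι (by rw [h, Ideal.map_top])
    have hKπ := map_ne_top_of_ker hπ hKt
    obtain ⟨J1, h1 | ⟨-, c, hcl, hr, hcJ, rfl⟩, h2⟩ := h
    · exact absurd h1.1 hKπ
    have hlift : ∃ c' : List T, c'.map π = c ∧ ∀ x ∈ c', x ∈ K := by
      clear hr hcl h2
      induction c with
      | nil => exact ⟨[], rfl, by simp⟩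
      | cons x c ihc =>
        obtain ⟨c', rfl, hc'⟩ := ihc fun x hx => hcJ x (List.mem_cons_of_mem _ hx)
        obtain ⟨y, hy, rfl⟩ := (Ideal.mem_map_iff_of_surjective π hπ).1 (hcJ x (by simp))
        exact ⟨y :: c', rfl, by simpa using ⟨hy, hc'⟩⟩
    obtain ⟨c', rfl, hc'⟩ := hlift
    rw [List.length_map] at hcl
    subst hcl
    obtain ⟨hr', hxK', hD', e⟩ := lift_link hπ hxs hx hG hxK hD
      (fun x hx => le_maximalIdeal hKt (hc' x hx)) hc' hr
    rw [← e] at h2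
    obtain ⟨J', hJ', hle⟩ := ih hxK' hD' h2
    refine ⟨J', ⟨_, Or.inr ⟨hKι, c'.map ι, List.length_map _, ?_, ?_, ?_⟩, hJ'⟩, hle⟩
    · simpa using hι.regSeq_map hr'
    · intro x hx
      obtain ⟨y, hy, rfl⟩ := List.mem_map.1 hx
      exact Ideal.mem_map_of_mem _ (hc' y hy)
    · rw [hι.map_colon, map_ofList]

end Point

section Step
open MvPolynomial
variable {R : Type} [CommRing R] [IsLocalRing R] [IsNoetherianRing R] {m g : ℕ}
  {B : Type} [CommRing B] [IsLocalRing B] [IsNoetherianRing B]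
  {ψ : MvPolynomial (Fin m × Fin g) R →+* B}
  (hψ : IsLocAt ((maximalIdeal R).map (C : R →+* MvPolynomial (Fin m × Fin g) R)) ψ)

/-- The generic linear combinations of the family `f`. -/
noncomputable def genericComb (f : Fin m → R) (i : Fin g) : MvPolynomial (Fin m × Fin g) R :=
  ∑ j : Fin m, (X (j, i) : MvPolynomial (Fin m × Fin g) R) * C (f j)

theorem genericComb_mem {f : Fin m → R} {I : Ideal R} (hf : Ideal.span (Set.range f) = I)
    (i : Fin g) : genericComb f i ∈ I.map (C : R →+* MvPolynomial (Fin m × Fin g) R) :=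
  Ideal.sum_mem _ fun j _ => Ideal.mul_mem_left _ _
    (Ideal.mem_map_of_mem _ (hf ▸ Ideal.subset_span ⟨j, rfl⟩))

theorem ofList_ofFn {A : Type*} [CommRing A] {n : ℕ} (c : Fin n → A) :
    Ideal.ofList (List.ofFn c) = Ideal.span (Set.range c) := by
  have h : {x | x ∈ List.ofFn c} = Set.range c := by
    ext z
    simp [List.mem_ofFn]
  exact congrArg Ideal.span h

include hψ

theorem map_genericLinkIdeal (f : Fin m → R) (I : Ideal R) :
    (genericLinkIdeal g f I).map ψ =
      (Ideal.ofList (List.ofFn fun i : Fin g => ψ (genericComb f i))).colon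
        (I.map (ψ.comp C) : Set B) := by
  rw [ofList_ofFn]
  have h := hψ.map_colon (Ideal.span (Set.range fun i : Fin g => genericComb f i)) (I.map C)
  rw [Ideal.map_map, Ideal.map_span, ← Set.range_comp] at h
  exact h

theorem exists_wChain_genericLinkIdeal {f : Fin m → R} {I : Ideal R}
    (hf : Ideal.span (Set.range f) = I) {r : ℕ} (hG : Gor (g + r) (⊥ : Ideal R)) (hD : Dep r I)
    (hI : I ≠ ⊤) {c : List R} (hcl : c.length = g) (hr : RegSeq ⊥ c) (hcI : ∀ x ∈ c, x ∈ I) :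
    RegSeq ⊥ (List.ofFn fun i : Fin g => ψ (genericComb f i)) ∧
    ∀ n J, WChain g n ((Ideal.ofList c).colon (I : Set R)) J →
      ∃ J', WChain g n ((genericLinkIdeal g f I).map ψ) J' ∧
        ∀ D : Ideal R, D ≠ ⊤ → J' ≤ D.map (ψ.comp C) → J ≤ D := by
  obtain ⟨c0, rfl⟩ : ∃ c0 : Fin g → R, List.ofFn c0 = c := by
    subst hcl
    exact ⟨c.get, List.ofFn_get c⟩
  have h1 : ∀ i, ∃ ρ : Fin m → R, ∑ j, ρ j * f j = c0 i := fun i => by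
    rw [← mem_span_range, hf]
    exact hcI _ (by simp [List.mem_ofFn])
  choose ρ hρ using h1
  let lam : Fin m × Fin g → R := fun p => ρ p.2 p.1
  obtain ⟨T, _, _, _, τ, π, ι, hτ, hπ, hπτ, hιτ, hι⟩ := exists_local hψ lam
  have hprime : ((maximalIdeal B).comap ι).IsPrime := Ideal.IsPrime.comap _
  have hprime' : ((maximalIdeal R).comap (eval lam)).IsPrime := Ideal.IsPrime.comap _
  let l : List (Fin m × Fin g) := Finset.univ.toList
  have hl : ∀ i, i ∈ l := by simp [l]
  have hxs := ker_of_isLocAt hτ hπτ hl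
  have hxa := fun a => regSeq_map_comp_C hτ a (Finset.nodup_toList Finset.univ : l.Nodup)
  set xs := l.map fun i => τ (X i - C (lam i)) with hxsdef
  have hx0 := hxa ⊥
  rw [Ideal.map_bot] at hx0
  have hG' : Gor (xs.length + (g + r)) (⊥ : Ideal T) := Gor.lift hπ hxs hx0 (by rwa [Ideal.map_bot])
  have hD' := Dep.lift hπ hxs (hxa I) (r := r) (by rwa [map_comp_C_map hπτ])
  have hp := RingHom.congr_fun hπτ
  have hi := RingHom.congr_fun hιτ
  simp only [RingHom.comp_apply] at hp hi
  let c' : List T := List.ofFn fun i : Fin g => τ (genericComb f i)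
  have hc'π : c'.map π = List.ofFn c0 := by
    rw [List.map_ofFn]
    congr 1
    ext i
    simp only [Function.comp_apply, hp, genericComb, map_sum, map_mul, eval_X, eval_C]
    exact hρ i
  have hc'ι : c'.map ι = List.ofFn fun i : Fin g => ψ (genericComb f i) := by
    rw [List.map_ofFn]
    congr 1
    ext i
    simp only [Function.comp_apply, hi]
  have hc'I : ∀ x ∈ c', x ∈ I.map (τ.comp C) := by
    intro x hx
    obtain ⟨i, rfl⟩ := (List.mem_ofFn' _ _).1 hx
    rw [← Ideal.map_map]
    exact Ideal.mem_map_of_mem τ (genericComb_mem hf i)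
  have hIT : I.map (τ.comp C) ≠ ⊤ := fun h => hI (by
    rw [← map_comp_C_map hπτ I, h, Ideal.map_top])
  obtain ⟨hr', hx', hD'', e⟩ := lift_link hπ hxs hx0 (c := c') (r := r)
    (by rwa [List.length_ofFn]) (hxa I) hD' (fun x hx => le_maximalIdeal hIT (hc'I x hx)) hc'I
    (by rwa [hc'π])
  refine ⟨?_, fun n J hJ => ?_⟩
  · have := hι.regSeq_map hr'
    rwa [Ideal.map_bot, hc'ι] at this
  · rw [hc'π, map_comp_C_map hπτ] at e
    rw [← e] at hJ
    have := exists_wChain hψ hτ hπ hπτ hιτ hι hxs hx0 hG' hx' hD'' hJ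
    have e2 : I.map (ψ.comp C) = (I.map (τ.comp C)).map ι := by
      rw [Ideal.map_map, ← RingHom.comp_assoc, hιτ]
    rwa [hι.map_colon, map_ofList, hc'ι, ← e2, ← map_genericLinkIdeal hψ] at this

/-- The properties of the first universal link. -/
theorem universal_step {f : Fin m → R} {I : Ideal R}
    (hf : Ideal.span (Set.range f) = I) {r : ℕ} (hG : Gor (g + r) (⊥ : Ideal R)) (hD : Dep r I)
    (hI : I ≠ ⊤) (hg : MaxReg g I) :
    Dep r ((genericLinkIdeal g f I).map ψ) ∧
    ((genericLinkIdeal g f I).map ψ ≠ ⊤ → MaxReg g ((genericLinkIdeal g f I).map ψ) ∧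
      IsDirectlyLinked B (I.map (ψ.comp C)) ((genericLinkIdeal g f I).map ψ)) ∧
    ∀ n J, WChain g (n + 1) I J →
      ∃ J', WChain g n ((genericLinkIdeal g f I).map ψ) J' ∧
        ∀ D : Ideal R, D ≠ ⊤ → J' ≤ D.map (ψ.comp C) → J ≤ D := by
  obtain ⟨c, hcl, hcI, hr, -⟩ := hg.exists_list
  have hra := (exists_wChain_genericLinkIdeal hψ hf hG hD hI hcl hr hcI).1
  have e := map_genericLinkIdeal hψ f I
  set a := List.ofFn fun i : Fin g => ψ (genericComb f i) with ha
  have haI : ∀ x ∈ a, x ∈ I.map (ψ.comp C) := by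
    intro x hx
    obtain ⟨i, rfl⟩ := (List.mem_ofFn' _ _).1 hx
    rw [← Ideal.map_map]
    exact Ideal.mem_map_of_mem ψ (genericComb_mem hf i)
  have hIB := hψ.map_comp_ne_top hI
  have hGB : Gor r (Ideal.ofList a) := by
    have h := hψ.gor hG
    rw [Ideal.map_bot] at h
    have h2 : Gor (a.length + r) (⊥ : Ideal B) := by rwa [ha, List.length_ofFn]
    simpa using h2.exchange_list a (fun x hx => le_maximalIdeal hIB (haI x hx)) hra
  obtain ⟨-, hdual, hD'⟩ := duality r (Ideal.span_le.2 haI) hGB (hψ.dep hD)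
  have hdual' : (Ideal.ofList a).colon ((genericLinkIdeal g f I).map ψ : Set B) =
    I.map (ψ.comp C) := by rw [e]; exact hdual
  have haL : ∀ x ∈ a, x ∈ (genericLinkIdeal g f I).map ψ := by
    intro x hx
    rw [e]
    exact mem_colon_ideal.2 fun k _ => Ideal.mul_mem_right _ _ (Ideal.subset_span hx)
  refine ⟨e ▸ hD', fun hL => ⟨?_, ?_⟩, ?_⟩
  · exact (link_maxReg hIB hL hra haI haL hdual' e.symm (hψ.maxReg hg)).2
  · exact isDirectlyLinked_iff.2 ⟨hIB, hL, a, hra, haI, haL, hdual', e.symm⟩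
  · rintro n J ⟨K, h | ⟨-, c, hcl, hr, hcI, rfl⟩, h2⟩
    · exact absurd h.1 hI
    · exact (exists_wChain_genericLinkIdeal hψ hf hG hD hI hcl hr hcI).2 n J h2

/-- The first universal link of the unit ideal is the unit ideal. -/
theorem map_genericLinkIdeal_top (f : Fin m → R) (hf : Ideal.span (Set.range f) = ⊤)
    (hg : 1 ≤ g) : (genericLinkIdeal g f (⊤ : Ideal R)).map ψ = ⊤ := by
  rw [map_genericLinkIdeal hψ, Ideal.map_top]
  suffices h : Ideal.ofList (List.ofFn fun i : Fin g => ψ (genericComb f i)) = ⊤ by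
    rw [h, Ideal.eq_top_iff_one, mem_colon_ideal]
    exact fun k _ => trivial
  let i : Fin g := ⟨0, hg⟩
  refine Ideal.eq_top_of_isUnit_mem _ (x := ψ (genericComb f i))
    (Ideal.subset_span (by simp [List.mem_ofFn])) (hψ.isUnit _ fun h => ?_)
  apply (maximalIdeal.isMaximal R).ne_top
  rw [← top_le_iff, ← hf, Ideal.span_le]
  rintro _ ⟨j, rfl⟩
  classical
  have h1 := mem_map_C_iff.1 h (Finsupp.single (j, i) 1)
  have h2 : coeff (Finsupp.single (j, i) 1) (genericComb f i) = f j := by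
    rw [genericComb, coeff_sum, Finset.sum_eq_single j]
    · rw [mul_comm, coeff_C_mul, coeff_X, if_pos rfl, mul_one]
    · intro k _ hk
      rw [mul_comm, coeff_C_mul, coeff_X, if_neg, mul_zero]
      intro h
      have := Finsupp.single_left_injective one_ne_zero h
      simp_all
    · simp
  rwa [h2] at h1

end Step

section Generic
open MvPolynomial

theorem finite_aeval_update_eq_zero {k : Type*} [Field k] {σ : Type*} [DecidableEq σ]
    {H : MvPolynomial σ k} (hH : H ≠ 0) (i : σ) :
    {c : k | aeval (Function.update X i (C c) : σ → MvPolynomial σ k) H = 0}.Finite := by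
  let p : Polynomial (MvPolynomial σ k) :=
    aeval (Function.update (fun j => Polynomial.C (X j)) i Polynomial.X) H
  have hp : ∀ x : MvPolynomial σ k, p.eval x = aeval (Function.update X i x) H := by
    intro x
    have : aeval (R := k) (Function.update X i x : σ → MvPolynomial σ k) =
        ((Polynomial.aeval x : Polynomial (MvPolynomial σ k) →ₐ[MvPolynomial σ k]
          MvPolynomial σ k).restrictScalars k).comp
          (aeval (Function.update (fun j => Polynomial.C (X j)) i Polynomial.X)) := by
      apply MvPolynomial.algHom_ext
      intro j
      by_cases hj : j = i
      · subst hj; simp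
      · simp [hj]
    rw [this]
    rfl
  have hp0 : p ≠ 0 := by
    intro h
    have h1 := hp (X i)
    rw [h, Polynomial.eval_zero, Function.update_eq_self, aeval_X_left] at h1
    exact hH (by simpa using h1.symm)
  refine Set.Finite.of_finite_image (f := (C : k → MvPolynomial σ k)) ?_
    (C_injective σ k).injOn
  refine p.rootSet_finite (MvPolynomial σ k) |>.subset ?_
  rintro _ ⟨c, hc, rfl⟩
  rw [Polynomial.mem_rootSet]
  refine ⟨hp0, ?_⟩
  rw [Polynomial.coe_aeval_eq_eval, hp]
  exact hc

variable {R : Type*} [CommRing R] [IsLocalRing R] [IsNoetherianRing R] {σ : Type*} [Finite σ]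

theorem finite_not_regMod (K : Ideal (MvPolynomial σ R)) (i : σ) :
    {c : ResidueField R | ∃ b, residue R b = c ∧ ¬ RegMod K (X i - C b)}.Finite := by
  have h1 : {c : ResidueField R | ∃ b, residue R b = c ∧ ¬ RegMod K (X i - C b)} ⊆
      ⋃ P ∈ associatedPrimes (MvPolynomial σ R) (MvPolynomial σ R ⧸ K),
        {c | ∃ b, residue R b = c ∧ (X i - C b : MvPolynomial σ R) ∈ P} := by
    rintro c ⟨b, hb, h⟩
    rw [regMod_iff_notMem_associatedPrimes] at h
    push Not at h
    obtain ⟨P, hP, h⟩ := h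
    exact Set.mem_biUnion hP ⟨b, hb, h⟩
  refine ((associatedPrimes.finite _ _).biUnion fun P hP => ?_).subset h1
  refine Set.Subsingleton.finite ?_
  rintro _ ⟨b, rfl, hb⟩ _ ⟨b', rfl, hb'⟩
  by_contra hne
  have h2 := P.sub_mem hb' hb
  have h3 : (X i - C b' - (X i - C b) : MvPolynomial σ R) = C (b - b') := by
    rw [C_sub]; ring
  rw [h3] at h2
  have hu : IsUnit (b - b') := by
    by_contra hu
    apply hne
    rw [← sub_eq_zero, ← map_sub, residue_eq_zero_iff]
    exact (mem_maximalIdeal _).2 hu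
  exact (IsAssociatedPrime.isPrime hP).ne_top (Ideal.eq_top_of_isUnit_mem _ h2 (hu.map C))

theorem exists_generic_aux [Infinite (ResidueField R)] [DecidableEq σ]
    (Ks : List (Ideal (MvPolynomial σ R))) {H : MvPolynomial σ (ResidueField R)} (hH : H ≠ 0)
    (l : List σ) (hl : l.Nodup) : ∃ lam : σ → R,
      (∀ K ∈ Ks, RegSeq K (l.map fun i => X i - C (lam i))) ∧
      aeval (fun i => if i ∈ l then C (residue R (lam i)) else X i :
        σ → MvPolynomial σ (ResidueField R)) H ≠ 0 := by
  induction l using List.reverseRecOn with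
  | nil =>
    refine ⟨0, fun K _ => trivial, ?_⟩
    simpa [aeval_X_left] using hH
  | append_singleton l i ih =>
    rw [List.nodup_append'] at hl
    have hi : i ∉ l := fun h => hl.2.2 h (by simp)
    obtain ⟨lam, h1, h2⟩ := ih hl.1
    have hfin := (finite_aeval_update_eq_zero h2 i).union
      ((List.finite_toSet Ks).biUnion fun K _ =>
        finite_not_regMod (K ⊔ Ideal.ofList (l.map fun j => X j - C (lam j))) i)
    obtain ⟨c, hc⟩ := hfin.exists_notMem
    obtain ⟨b, rfl⟩ := residue_surjective c
    simp only [Set.mem_union, Set.mem_ofPred_eq, Set.mem_iUnion, not_or, not_exists,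
      not_and, not_not] at hc
    have hmap : (l.map fun j => (X j - C (Function.update lam i b j) : MvPolynomial σ R)) =
        l.map fun j => X j - C (lam j) := by
      refine List.map_congr_left fun j hj => ?_
      have hne : j ≠ i := fun h => hi (by rw [← h]; exact hj)
      rw [Function.update_of_ne hne]
    refine ⟨Function.update lam i b, fun K hK => ?_, ?_⟩
    · rw [List.map_append, regSeq_append, hmap]
      refine ⟨h1 K hK, ?_, trivial⟩
      show RegMod _ (X i - C (Function.update lam i b i))
      rw [Function.update_self]
      exact hc.2 K hK b rfl
    · have e : aeval (R := ResidueField R) (fun j => if j ∈ l ++ [i] then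
          C (residue R (Function.update lam i b j)) else X j :
            σ → MvPolynomial σ (ResidueField R)) =
          (aeval (Function.update X i (C (residue R b)))).comp (aeval (fun j => if j ∈ l then
            C (residue R (lam j)) else X j : σ → MvPolynomial σ (ResidueField R))) := by
        apply MvPolynomial.algHom_ext
        intro j
        by_cases hj : j = i
        · subst hj; simp [hi]
        · by_cases hjl : j ∈ l <;> simp [hj, hjl]
      rw [e]
      exact hc.1

theorem exists_generic [Infinite (ResidueField R)]
    (Ks : List (Ideal (MvPolynomial σ R))) {H : MvPolynomial σ (ResidueField R)} (hH : H ≠ 0)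
    (l : List σ) (hl : l.Nodup) (hl' : ∀ i, i ∈ l) : ∃ lam : σ → R,
      (∀ K ∈ Ks, RegSeq K (l.map fun i => X i - C (lam i))) ∧
      eval (fun i => residue R (lam i)) H ≠ 0 := by
  classical
  obtain ⟨lam, h1, h2⟩ := exists_generic_aux Ks hH l hl
  refine ⟨lam, h1, fun h => h2 ?_⟩
  simp only [hl', if_true]
  have : aeval (R := ResidueField R)
      (fun i => (C (residue R (lam i)) : MvPolynomial σ (ResidueField R))) =
      (Algebra.ofId (ResidueField R) (MvPolynomial σ (ResidueField R))).comp
        (aeval fun i => residue R (lam i)) := by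
    ext; simp [Algebra.ofId_apply]
  rw [this, AlgHom.comp_apply, aeval_eq_eval]
  change (Algebra.ofId _ _) (eval _ H) = 0
  rw [h, map_zero]

/-- A polynomial outside an extended ideal stays outside the ideal at a generic point. -/
theorem exists_eval_notMem {D : Ideal R} {F : MvPolynomial σ R}
    (hF : F ∉ D.map (C : R →+* MvPolynomial σ R)) :
    ∃ H : MvPolynomial σ (ResidueField R), H ≠ 0 ∧
      ∀ lam : σ → R, eval (fun i => residue R (lam i)) H ≠ 0 → eval lam F ∉ D := by
  classical
  have hS : ({U : Ideal R | D ≤ U ∧ ∃ d, coeff d F ∉ U}).Nonempty := by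
    rw [mem_map_C_iff] at hF
    push Not at hF
    exact ⟨D, le_rfl, hF⟩
  obtain ⟨U, ⟨hDU, d0, hd0⟩, hmax⟩ :=
    (wellFounded_gt : WellFounded ((· > ·) : Ideal R → Ideal R → Prop)).has_min _ hS
  set w := coeff d0 F
  have h1 : ∀ d, ∃ c, coeff d F - c * w ∈ U := by
    intro d
    rw [← mem_sup_span_singleton]
    by_contra hd
    refine hmax (U ⊔ Ideal.span {w}) ⟨hDU.trans le_sup_left, d, hd⟩ ?_
    refine lt_of_le_of_ne le_sup_left fun h => hd0 ?_
    rw [h]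
    exact Ideal.mem_sup_right (Ideal.mem_span_singleton_self w)
  choose c hc using h1
  let G : MvPolynomial σ R := ∑ d ∈ F.support, monomial d (c d)
  have hunit : ∀ u : R, u * w ∈ U → u ∈ maximalIdeal R := by
    intro u hu
    by_contra h
    refine hd0 (mul_mem_of_isUnit (u := u) ?_ (by rwa [mul_comm] at hu))
    by_contra hn
    exact h ((mem_maximalIdeal _).2 hn)
  have hFG : F - G * C w = ∑ d ∈ F.support, monomial d (coeff d F - c d * w) := by
    conv_lhs => rw [F.as_sum]
    simp only [G, Finset.sum_mul, ← Finset.sum_sub_distrib, monomial_mul, C_apply, add_zero,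
      map_sub]
  refine ⟨map (residue R) G, ?_, ?_⟩
  · intro h
    have hd0' : d0 ∈ F.support := by
      rw [mem_support_iff]
      exact fun h => hd0 (h ▸ U.zero_mem : coeff d0 F ∈ U)
    have h2 : coeff d0 G = c d0 := by
      simp only [G, coeff_sum, coeff_monomial, Finset.sum_ite_eq', if_pos hd0']
    have h3 := congrArg (coeff d0) h
    rw [coeff_map, h2, coeff_zero, residue_eq_zero_iff] at h3
    have h4 := hunit (1 - c d0) (by simpa [sub_mul, w] using hc d0)
    have h5 := Ideal.add_mem _ h3 h4
    rw [add_sub_cancel] at h5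
    exact (maximalIdeal.isMaximal R).ne_top ((Ideal.eq_top_iff_one _).2 h5)
  · intro lam hlam hFl
    have h2 : eval lam (F - G * C w) ∈ U := by
      rw [hFG, map_sum]
      refine U.sum_mem fun d _ => ?_
      rw [eval_monomial]
      exact U.mul_mem_right _ (hc d)
    rw [map_sub, map_mul, eval_C] at h2
    have h3 := U.sub_mem (hDU hFl) h2
    rw [sub_sub_cancel] at h3
    have h4 := hunit _ h3
    rw [← residue_eq_zero_iff] at h4
    apply hlam
    rw [← h4, eval_map]
    exact (eval₂_comp_left (residue R) (RingHom.id R) lam G).symm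

end Generic

section Descend
variable {A S T : Type*} [CommRing A] [CommRing S] [CommRing T] {P Q : Ideal A} [P.IsPrime]
  [Q.IsPrime] {ψ : A →+* S} {τ : A →+* T} (hψ : IsLocAt P ψ) (hτ : IsLocAt Q τ)

include hψ in
theorem IsLocAt.exists_saturation [IsNoetherianRing A] (a : Ideal A) :
    ∃ G, G ∉ P ∧ ∀ z, ψ z ∈ a.map ψ → G * z ∈ a := by
  obtain ⟨n, k, hk⟩ := Submodule.fg_iff_exists_fin_generating_family.1
    (IsNoetherian.noetherian ((a.map ψ).comap ψ))
  obtain ⟨t, ht, htk⟩ := exists_common_of_notMem (P := P) (a := a) k (fun j => by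
    have : k j ∈ (a.map ψ).comap ψ := hk ▸ Submodule.subset_span ⟨j, rfl⟩
    exact hψ.mem_map_iff.1 this)
  refine ⟨t, ht, fun z hz => ?_⟩
  have hz' : z ∈ (a.map ψ).comap ψ := hz
  rw [← hk] at hz'
  obtain ⟨ρ, rfl⟩ := mem_span_range.1 hz'
  rw [Finset.mul_sum]
  refine a.sum_mem fun j _ => ?_
  have := a.mul_mem_left (ρ j) (htk j)
  convert this using 1
  ring

include hψ hτ in
theorem IsLocAt.regMod_of_saturation (hPQ : P ≤ Q) {a : Ideal A} {G : A} (hG : G ∉ Q)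
    (hGa : ∀ z, ψ z ∈ a.map ψ → G * z ∈ a) {x : A} (hx : RegMod (a.map ψ) (ψ x)) :
    RegMod (a.map τ) (τ x) := by
  intro z hz
  obtain ⟨F, u, hu, e⟩ := hτ.surj z
  have h1 : τ (x * F) ∈ a.map τ := by
    rw [map_mul, ← e, ← mul_assoc]
    exact Ideal.mul_mem_right _ _ hz
  obtain ⟨s, hs, h2⟩ := hτ.mem_map_iff.1 h1
  have h3 : ψ F ∈ a.map ψ := by
    apply hx
    rw [← map_mul, hψ.mem_map_iff]
    exact ⟨s, fun h => hs (hPQ h), h2⟩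
  refine mul_mem_of_isUnit (hτ.isUnit u hu) ?_
  rw [e, hτ.mem_map_iff]
  exact ⟨G, hG, hGa F h3⟩

include hψ in
theorem IsLocAt.exists_regSeq [IsNoetherianRing A] {a : Ideal A} {l : List A}
    (h : RegSeq (a.map ψ) (l.map ψ)) : ∃ G, G ∉ P ∧ ∀ {Q : Ideal A} [Q.IsPrime]
      {T : Type} [CommRing T] {τ : A →+* T}, IsLocAt Q τ → P ≤ Q → G ∉ Q →
      RegSeq (a.map τ) (l.map τ) := by
  induction l generalizing a with
  | nil => exact ⟨1, P.primeCompl.one_mem, fun _ _ _ => trivial⟩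
  | cons x l ih =>
    obtain ⟨G, hG, hGa⟩ := hψ.exists_saturation a
    obtain ⟨G', hG', h'⟩ := ih (a := a ⊔ Ideal.span {x}) (by
      rw [Ideal.map_sup, Ideal.map_span, Set.image_singleton]
      exact h.2)
    refine ⟨G * G', P.primeCompl.mul_mem hG hG', fun {Q} _ {T} _ {τ} hτ hPQ hGQ => ⟨?_, ?_⟩⟩
    · exact hψ.regMod_of_saturation hτ hPQ (fun h => hGQ (Q.mul_mem_right _ h)) hGa h.1
    · have := h' hτ hPQ (fun h => hGQ (Q.mul_mem_left _ h))
      rwa [Ideal.map_sup, Ideal.map_span, Set.image_singleton] at this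

include hψ in
theorem IsLocAt.exists_list (c : List S) : ∃ l : List A, l.length = c.length ∧
    Ideal.ofList (l.map ψ) = Ideal.ofList c ∧ ∀ a, RegSeq a c → RegSeq a (l.map ψ) := by
  induction c with
  | nil => exact ⟨[], rfl, rfl, fun _ _ => trivial⟩
  | cons x c ih =>
    obtain ⟨l, h1, h2, h3⟩ := ih
    obtain ⟨F, u, hu, e⟩ := hψ.surj x
    have hs : Ideal.span {ψ F} = Ideal.span {x} := by
      rw [← e]
      exact Ideal.span_singleton_mul_right_unit (hψ.isUnit u hu) x
    refine ⟨F :: l, by simp [h1], ?_, fun a h => ⟨?_, ?_⟩⟩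
    · rw [List.map_cons, Ideal.ofList_cons, Ideal.ofList_cons, h2, hs]
    · intro z hz
      rw [← e, mul_assoc] at hz
      have h4 := h.1 _ hz
      rw [mul_comm] at h4
      exact mul_mem_of_isUnit (hψ.isUnit u hu) h4
    · rw [hs]
      exact h3 _ h.2

end Descend

section Special
open MvPolynomial
variable {R : Type} [CommRing R] [IsLocalRing R] [IsNoetherianRing R] {σ : Type} [Finite σ]
  {B : Type} [CommRing B] [IsLocalRing B] [IsNoetherianRing B] {ψ : MvPolynomial σ R →+* B}

/-- The intermediate local ring `T` of `R[X]` at the point `lam`, with its maps to `R` and `B`. -/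
structure IsPoint {T : Type} [CommRing T] (ψ : MvPolynomial σ R →+* B) (lam : σ → R)
    (τ : MvPolynomial σ R →+* T) (π : T →+* R) (ι : T →+* B) : Prop where
  isLocAt : IsLocAt ((maximalIdeal R).comap (eval lam)) τ
  surj : Function.Surjective π
  comp_eval : π.comp τ = eval lam
  comp_generic : ι.comp τ = ψ
  isLocAt_generic : IsLocAt ((maximalIdeal B).comap ι) ι

section Point
variable {T : Type} [CommRing T] [IsLocalRing T] [IsNoetherianRing T]
  {lam : σ → R} {τ : MvPolynomial σ R →+* T} {π : T →+* R} {ι : T →+* B}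
  (hp : IsPoint ψ lam τ π ι)
include hp

theorem IsPoint.isPrime_comap_eval : ((maximalIdeal R).comap (eval lam)).IsPrime :=
  Ideal.IsPrime.comap _

theorem IsPoint.map_comap (K : Ideal B) : (K.comap ψ).map τ = K.comap ι := by
  rw [← hp.comp_generic, ← Ideal.comap_comap, hp.isLocAt.map_comap]

theorem IsPoint.map_comap_eval (K : Ideal B) : (K.comap ψ).map (eval lam) = (K.comap ι).map π := by
  rw [← hp.map_comap, Ideal.map_map, hp.comp_eval]

theorem IsPoint.regSeq_comap_generic {K : Ideal B} {l : List σ}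
    (h : RegSeq (K.comap ψ) (l.map fun i => X i - C (lam i))) :
    RegSeq (K.comap ι) (l.map fun i => τ (X i - C (lam i))) := by
  have := hp.isPrime_comap_eval
  have h1 := hp.isLocAt.regSeq_map h
  rw [hp.map_comap, List.map_map] at h1
  exact h1

theorem IsPoint.comap_ofList {c : List (MvPolynomial σ R)} {G : MvPolynomial σ R}
    (hG : eval lam G ∉ maximalIdeal R)
    (hGc : ∀ z, ψ z ∈ (Ideal.ofList c).map ψ → G * z ∈ Ideal.ofList c) :
    (Ideal.ofList (c.map ψ)).comap ι = Ideal.ofList (c.map τ) := by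
  rw [← map_ofList, ← map_ofList]
  apply le_antisymm
  · rw [← hp.map_comap, Ideal.map_le_iff_le_comap]
    intro F hF
    have h1 := Ideal.mem_map_of_mem τ (hGc F hF)
    rw [mul_comm, map_mul] at h1
    exact mul_mem_of_isUnit (K := (Ideal.ofList c).map τ) (hp.isLocAt.isUnit G hG) h1
  · rw [← hp.comp_generic, ← Ideal.map_map]
    exact Ideal.le_comap_map

theorem IsPoint.comap_ne_top {K : Ideal B} (hK : K ≠ ⊤) : K.comap ι ≠ ⊤ := by
  intro h
  rw [Ideal.eq_top_iff_one, Ideal.mem_comap, map_one] at h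
  exact hK ((Ideal.eq_top_iff_one _).2 h)

theorem IsPoint.comap_colon {a K J : Ideal B} (h : a.colon (K : Set B) = J) :
    (a.comap ι).colon (K.comap ι : Set T) = J.comap ι := by
  subst h
  ext z
  rw [mem_colon_ideal, Ideal.mem_comap, mem_colon_ideal]
  constructor
  · intro hz k hk
    rw [← hp.isLocAt_generic.map_comap K] at hk
    have hle : (K.comap ι).map ι ≤ a.colon {ι z} := by
      rw [Ideal.map_le_iff_le_comap]
      intro y hy
      rw [Ideal.mem_comap, Submodule.mem_colon_singleton, smul_eq_mul, mul_comm, ← map_mul]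
      exact hz y hy
    have h := hle hk
    rwa [Submodule.mem_colon_singleton, smul_eq_mul, mul_comm] at h
  · intro hz k hk
    rw [Ideal.mem_comap, map_mul]
    exact hz _ hk

/-- A direct link over `B` specializes to a direct link over `R` at a general enough point. -/
theorem IsPoint.isDirectlyLinked {l : List σ} (hl : ∀ i, i ∈ l) (hln : l.Nodup)
    {c : List (MvPolynomial σ R)} {r : ℕ} (hG : Gor (c.length + r) (⊥ : Ideal R)) {K K' : Ideal B}
    (hK : K ≠ ⊤) (hK' : K' ≠ ⊤) (hcK : ∀ x ∈ c.map ψ, x ∈ K) (hcK' : ∀ x ∈ c.map ψ, x ∈ K')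
    (h1 : (Ideal.ofList (c.map ψ)).colon (K' : Set B) = K)
    (h2 : (Ideal.ofList (c.map ψ)).colon (K : Set B) = K')
    (hcomap : (Ideal.ofList (c.map ψ)).comap ι = Ideal.ofList (c.map τ))
    (hcr : RegSeq ⊥ (c.map τ))
    (hrc : RegSeq (Ideal.ofList (c.map τ)) (l.map fun i => τ (X i - C (lam i))))
    (hrK : RegSeq (K.comap ι) (l.map fun i => τ (X i - C (lam i))))
    (hrK' : RegSeq (K'.comap ι) (l.map fun i => τ (X i - C (lam i))))
    (hD : Dep (l.length + r) (K.comap ι)) :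
    IsDirectlyLinked R ((K.comap ψ).map (eval lam)) ((K'.comap ψ).map (eval lam)) ∧
      Dep (l.length + r) (K'.comap ι) := by
  have hxs := ker_of_isLocAt hp.isLocAt hp.comp_eval hl
  have hx0 := regSeq_map_comp_C hp.isLocAt ⊥ hln
  rw [Ideal.map_bot] at hx0
  have hlen : (l.map fun i => τ (X i - C (lam i))).length = l.length := List.length_map _
  set xs := l.map fun i => τ (X i - C (lam i)) with hxsdef
  have hxm := mem_maximalIdeal_of_ker hp.surj hxs
  have hGT : Gor (xs.length + ((c.map τ).length + r)) (⊥ : Ideal T) :=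
    Gor.lift hp.surj hxs hx0 (by rwa [Ideal.map_bot, List.length_map])
  have hmem : ∀ {J : Ideal B}, (∀ x ∈ c.map ψ, x ∈ J) → ∀ x ∈ c.map τ, x ∈ J.comap ι := by
    intro J hJ x hx
    obtain ⟨y, hy, rfl⟩ := List.mem_map.1 hx
    rw [Ideal.mem_comap, ← RingHom.comp_apply, hp.comp_generic]
    exact hJ _ (List.mem_map_of_mem hy)
  have hcK1 := hmem hcK
  have hcK1' := hmem hcK'
  have hcm : ∀ x ∈ c.map τ, x ∈ maximalIdeal T := fun x hx =>
    le_maximalIdeal (hp.comap_ne_top hK) (hcK1 x hx)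
  have hcR : RegSeq (⊥ : Ideal R) ((c.map τ).map π) := by
    have h3 : RegSeq ⊥ (c.map τ ++ xs) := regSeq_append.2 ⟨hcr, by rwa [bot_sup_eq]⟩
    have h4 := (regSeq_append.1 (h3.perm List.perm_append_comm (fun x h =>
      (List.mem_append.1 h).elim (hcm x) (hxm x)))).2
    rwa [bot_sup_eq, ← hxs, regSeq_comap hp.surj] at h4
  have e1 := hp.comap_colon h1
  have e2 := hp.comap_colon h2
  rw [hcomap] at e1 e2
  rw [← hlen] at hD ⊢
  obtain ⟨-, -, hD', e3⟩ := lift_link hp.surj hxs hx0 hGT hrK hD hcm hcK1 hcR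
  rw [e2] at hD' e3
  obtain ⟨-, -, -, e4⟩ := lift_link hp.surj hxs hx0 hGT hrK' hD' hcm hcK1' hcR
  rw [e1] at e4
  refine ⟨isDirectlyLinked_iff.2 ?_, hD'⟩
  rw [hp.map_comap_eval, hp.map_comap_eval]
  have hπmem : ∀ {J : Ideal T}, (∀ x ∈ c.map τ, x ∈ J) → ∀ x ∈ (c.map τ).map π, x ∈ J.map π := by
    intro J hJ x hx
    obtain ⟨y, hy, rfl⟩ := List.mem_map.1 hx
    exact Ideal.mem_map_of_mem _ (hJ _ hy)
  exact ⟨map_ne_top_of_ker hp.surj (hp.comap_ne_top hK),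
    map_ne_top_of_ker hp.surj (hp.comap_ne_top hK'), (c.map τ).map π, hcR, hπmem hcK1, hπmem hcK1',
    e4.symm, e3.symm⟩

end Point

variable (hψ : IsLocAt ((maximalIdeal R).map (C : R →+* MvPolynomial σ R)) ψ)
include hψ

/-- Linkage chains over `B` specialize at general points. -/
theorem exists_linkedInSteps {l : List σ} (hl : ∀ i, i ∈ l) (hln : l.Nodup) {g r : ℕ}
    (hG : Gor (g + r) (⊥ : Ideal R)) {n : ℕ} {K J : Ideal B} (hg : MaxReg g K)
    (h : LinkedInSteps B n K J) :
    ∃ (Ks : List (Ideal (MvPolynomial σ R))) (H : MvPolynomial σ (ResidueField R)), H ≠ 0 ∧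
      ∀ lam : σ → R, (∀ K ∈ Ks, RegSeq K (l.map fun i => X i - C (lam i))) →
        eval (fun i => residue R (lam i)) H ≠ 0 →
        ∀ {T : Type} [CommRing T] [IsLocalRing T] [IsNoetherianRing T]
          {τ : MvPolynomial σ R →+* T} {π : T →+* R} {ι : T →+* B}, IsPoint ψ lam τ π ι →
          Dep (l.length + r) (K.comap ι) →
          LinkedInSteps R n ((K.comap ψ).map (eval lam)) ((J.comap ψ).map (eval lam)) := by
  induction n generalizing K with
  | zero =>
    obtain rfl : K = J := h
    exact ⟨[], 1, one_ne_zero, fun _ _ _ _ _ _ _ _ _ _ _ _ => rfl⟩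
  | succ n ih =>
    obtain ⟨K', hKK', hJ⟩ := h
    obtain ⟨hK, hK', c0, hr, hcK, hcK', h1, h2⟩ := isDirectlyLinked_iff.1 hKK'
    obtain ⟨hcl, hgK'⟩ := link_maxReg hK hK' hr hcK hcK' h1 h2 hg
    obtain ⟨Ks, H, hH, hlam⟩ := ih hgK' hJ
    obtain ⟨c, hcl', hc0, hcr⟩ := hψ.exists_list c0
    have hr' := hcr ⊥ hr
    rw [hcl] at hcl'
    subst hcl'
    rw [← hc0] at h1 h2
    have hcmem : ∀ {M : Ideal B}, (∀ x ∈ c0, x ∈ M) → ∀ x ∈ c.map ψ, x ∈ M := by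
      intro M hM x hx
      have h3 : Ideal.ofList c0 ≤ M := Ideal.span_le.2 hM
      exact h3 (hc0 ▸ Ideal.subset_span hx)
    have hr'' : RegSeq ((⊥ : Ideal (MvPolynomial σ R)).map ψ) (c.map ψ) := by
      rwa [Ideal.map_bot]
    obtain ⟨G1, hG1, hreg⟩ := hψ.exists_regSeq hr''
    obtain ⟨G2, hG2, hsat⟩ := hψ.exists_saturation (Ideal.ofList c)
    obtain ⟨H1, hH1, hHl1⟩ := exists_eval_notMem hG1
    obtain ⟨H2, hH2, hHl2⟩ := exists_eval_notMem hG2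
    refine ⟨K.comap ψ :: K'.comap ψ :: (Ideal.ofList (c.map ψ)).comap ψ :: Ks, H1 * H2 * H,
      mul_ne_zero (mul_ne_zero hH1 hH2) hH, fun lam hKs hHlam T _ _ _ τ π ι hp hD => ?_⟩
    simp only [List.forall_mem_cons] at hKs
    obtain ⟨hr1, hr2, hr3, hKs⟩ := hKs
    rw [map_mul, map_mul] at hHlam
    have hn := left_ne_zero_of_mul hHlam
    have hcomap := hp.comap_ofList (hHl2 lam (right_ne_zero_of_mul hn)) hsat
    have hprime := hp.isPrime_comap_eval
    have hPQ : (maximalIdeal R).map (C : R →+* MvPolynomial σ R) ≤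
        (maximalIdeal R).comap (eval lam) := by
      rw [Ideal.map_le_iff_le_comap]
      intro b hb
      simpa using hb
    have hcτ := hreg hp.isLocAt hPQ (hHl1 lam (left_ne_zero_of_mul hn))
    rw [Ideal.map_bot] at hcτ
    have hr3' := hp.regSeq_comap_generic hr3
    rw [hcomap] at hr3'
    obtain ⟨hlink, hD'⟩ := hp.isDirectlyLinked hl hln hG hK hK' (hcmem hcK) (hcmem hcK') h1 h2
      hcomap hcτ hr3' (hp.regSeq_comap_generic hr1) (hp.regSeq_comap_generic hr2) hD
    exact ⟨_, hlink, hlam lam hKs (right_ne_zero_of_mul hHlam) hp hD'⟩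

theorem comap_map_comp (I : Ideal R) :
    (I.map (ψ.comp C)).comap ψ = I.map (C : R →+* MvPolynomial σ R) := by
  ext F
  exact hψ.mem_map_comp_iff

/-- If everything linked to `I` in `n` steps lies in `D`, then the same holds over `B`. -/
theorem le_map_of_linkedInSteps [Infinite (ResidueField R)] {g r n : ℕ} {I D : Ideal R}
    (hG : Gor (g + r) (⊥ : Ideal R)) (hg : MaxReg g I) (hI : Dep r I)
    (hD : ∀ J, LinkedInSteps R n I J → J ≤ D) {J : Ideal B}
    (hJ : LinkedInSteps B n (I.map (ψ.comp C)) J) : J ≤ D.map (ψ.comp C) := by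
  classical
  have := Fintype.ofFinite σ
  let l : List σ := Finset.univ.toList
  have hl : ∀ i, i ∈ l := fun i => Finset.mem_toList.2 (Finset.mem_univ i)
  have hln : l.Nodup := Finset.nodup_toList _
  obtain ⟨Ks, H, hH, hlam⟩ := exists_linkedInSteps hψ hl hln hG (hψ.maxReg hg) hJ
  by_contra hcon
  have hcon' : ∃ F ∈ J.comap ψ, F ∉ D.map (C : R →+* MvPolynomial σ R) := by
    by_contra! h
    apply hcon
    rw [← hψ.map_comap J, ← Ideal.map_map]
    exact Ideal.map_mono h
  obtain ⟨F, hFJ, hF⟩ := hcon'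
  obtain ⟨H', hH', hHl'⟩ := exists_eval_notMem hF
  obtain ⟨lam, hK, hHlam⟩ := exists_generic Ks (mul_ne_zero hH hH') l hln hl
  rw [map_mul] at hHlam
  obtain ⟨T, _, _, _, τ, π, ι, h1, h2, h3, h4, h5⟩ := exists_local hψ lam
  have hp : IsPoint ψ lam τ π ι := ⟨h1, h2, h3, h4, h5⟩
  have hcomap : (I.map (ψ.comp C)).comap ι = I.map (τ.comp C) := by
    rw [← hp.map_comap, comap_map_comp hψ, Ideal.map_map]
  have hdep : Dep (l.length + r) ((I.map (ψ.comp C)).comap ι) := by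
    rw [hcomap]
    have := Dep.lift h2 (ker_of_isLocAt h1 h3 hl) (regSeq_map_comp_C h1 I hln) (r := r)
      (by rwa [map_comp_C_map h3])
    rwa [List.length_map] at this
  have hlink := hlam lam hK (left_ne_zero_of_mul hHlam) hp hdep
  rw [comap_map_comp hψ, map_C_map_eval] at hlink
  exact hHl' lam (right_ne_zero_of_mul hHlam) (hD _ hlink (Ideal.mem_map_of_mem _ hFJ))

end Special

section Stage
open MvPolynomial

/-- The inductive properties of a `k`-th universal link `L` of `I`, where `g` is the grade of `I`
and `g + r` is the dimension of the ring. -/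
structure UniversalStage {R : Type} [CommRing R] (I : Ideal R) (g r k : ℕ) {B : Type} [CommRing B]
    [IsLocalRing B] (φ : R →+* B) (L : Ideal B) : Prop where
  noetherian : IsNoetherianRing B
  infinite : Infinite (ResidueField B)
  gor : Gor (g + r) (⊥ : Ideal B)
  dep : Dep r L
  maxReg : L ≠ ⊤ → MaxReg g L
  map_ne_top : ∀ D : Ideal R, D ≠ ⊤ → D.map φ ≠ ⊤
  exists_chain : ∀ n J, WChain g (k + n) I J →
    ∃ J', WChain g n L J' ∧ ∀ D : Ideal R, D ≠ ⊤ → J' ≤ D.map φ → J ≤ D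
  le_map : L ≠ ⊤ → ∀ (n : ℕ) (D : Ideal R), (∀ J, LinkedInSteps R (k + n) I J → J ≤ D) →
    ∀ J', LinkedInSteps B n L J' → J' ≤ D.map φ

theorem IsLocAt.infinite_residueField {B S : Type} [CommRing B] [IsLocalRing B]
    [IsNoetherianRing B] [CommRing S] [IsLocalRing S] {σ : Type} [Finite σ]
    {ψ : MvPolynomial σ B →+* S} (hψ : IsLocAt ((maximalIdeal B).map (C : B →+* _)) ψ)
    [Infinite (ResidueField B)] : Infinite (ResidueField S) := by
  have : IsLocalHom (ψ.comp C) := ⟨fun b hb => by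
    by_contra h
    have h1 := Ideal.mem_map_of_mem (ψ.comp C) ((mem_maximalIdeal b).2 h)
    rw [hψ.map_maximalIdeal] at h1
    exact h1 hb⟩
  exact Infinite.of_injective _ (ResidueField.map (ψ.comp C)).injective

variable {R : Type} [CommRing R] {I : Ideal R} {g r k : ℕ} {B : Type} [CommRing B]
  [IsLocalRing B] {φ : R →+* B} {L : Ideal B}

theorem UniversalStage.succ (h : UniversalStage I g r k φ L) {g' m : ℕ} (hg' : 1 ≤ g')
    (hL : L ≠ ⊤ → g' = g) {S : Type} [CommRing S] [IsLocalRing S]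
    {ψ : MvPolynomial (Fin m × Fin g') B →+* S}
    (hψ : IsLocAt ((maximalIdeal B).map (C : B →+* MvPolynomial (Fin m × Fin g') B)) ψ)
    {f : Fin m → B} (hf : Ideal.span (Set.range f) = L) :
    UniversalStage I g r (k + 1) (ψ.comp (C.comp φ)) ((genericLinkIdeal g' f L).map ψ) := by
  have := h.noetherian
  have := h.infinite
  have hS : IsNoetherianRing S := hψ.isNoetherianRing
  have hmap : ∀ D : Ideal R, D.map (ψ.comp (C.comp φ)) = (D.map φ).map (ψ.comp C) := fun D => by
    rw [Ideal.map_map, RingHom.comp_assoc]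
  have hgor : Gor (g + r) (⊥ : Ideal S) := by
    have := hψ.gor h.gor
    rwa [Ideal.map_bot] at this
  have hne : ∀ D : Ideal R, D ≠ ⊤ → D.map (ψ.comp (C.comp φ)) ≠ ⊤ := fun D hD => by
    rw [hmap]
    exact hψ.map_comp_ne_top (h.map_ne_top D hD)
  by_cases hLt : L = ⊤
  · subst hLt
    have htop := map_genericLinkIdeal_top hψ f hf hg'
    refine ⟨hS, hψ.infinite_residueField, hgor, htop ▸ dep_top r, fun hn => absurd htop hn, hne,
      fun n J hJ => ?_, fun hn => absurd htop hn⟩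
    rw [htop]
    refine ⟨⊤, wChain_top g n, fun D hD hle => absurd (top_le_iff.1 hle) (hne D hD)⟩
  · obtain rfl := hL hLt
    obtain ⟨h1, h2, h3⟩ := universal_step hψ hf h.gor h.dep hLt (h.maxReg hLt)
    refine ⟨hS, hψ.infinite_residueField, hgor, h1, fun hn => (h2 hn).1, hne, fun n J hJ => ?_,
      fun hn n D hD J' hJ' => ?_⟩
    · rw [add_assoc, add_comm 1 n] at hJ
      obtain ⟨J1, hJ1, hD1⟩ := h.exists_chain (n + 1) J hJ
      obtain ⟨J2, hJ2, hD2⟩ := h3 n J1 hJ1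
      refine ⟨J2, hJ2, fun D hD hle => hD1 D hD (hD2 _ (h.map_ne_top D hD) ?_)⟩
      rwa [← hmap]
    · rw [hmap]
      refine le_map_of_linkedInSteps hψ h.gor (h.maxReg hLt) h.dep (n := n + 1) (fun J hJ => ?_)
        ⟨_, (h2 hn).2, hJ'⟩
      refine h.le_map hLt (n + 1) D ?_ J hJ
      rwa [add_assoc, add_comm 1 n] at hD

theorem exists_universalStage {R : Type} [CommRing R] [IsLocalRing R] [IsNoetherianRing R]
    [Infinite (ResidueField R)] {I : Ideal R} {g r : ℕ} (hg1 : 1 ≤ g)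
    (hG : Gor (g + r) (⊥ : Ideal R)) (hg : MaxReg g I) (hD : Dep r I) {k : ℕ} {B : CommRingCat.{0}}
    {φ : R →+* B} {L : Ideal B} (h : IsUniversalLinkOf R k I B φ L) :
    ∃ _ : IsLocalRing B, UniversalStage I g r k φ L := by
  induction h with
  | zero I =>
    refine ⟨‹IsLocalRing R›, ‹IsNoetherianRing R›, ‹Infinite (ResidueField R)›, hG, hD,
      fun _ => hg, fun D hDt => ?_, fun n J hJ => ?_, fun _ n D hDJ J hJ => ?_⟩
    · change D.map (RingHom.id R) ≠ ⊤
      rwa [Ideal.map_id]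
    · rw [zero_add] at hJ
      refine ⟨J, hJ, fun D _ hle => ?_⟩
      change J ≤ D.map (RingHom.id R) at hle
      rwa [Ideal.map_id] at hle
    · change J ≤ D.map (RingHom.id R)
      rw [Ideal.map_id]
      rw [zero_add] at hDJ
      exact hDJ J hJ
  | @succ k I B φ L h hB m f hf hQ ih =>
    obtain ⟨_, hst⟩ := ih hg hD
    have := hst.noetherian
    have hψ := isLocAt_algebraMap (P := (maximalIdeal B).map
      (C : B →+* MvPolynomial (Fin m × Fin (gradeOf B L)) B))
      (S := Localization (@Ideal.primeCompl _ _ _ hQ))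
    have hS := hψ.isLocalRing
    refine ⟨hS, hst.succ ?_ (fun hL => (hst.maxReg hL).gradeOf_eq hL) hψ hf⟩
    by_cases hL : L = ⊤
    · rw [hL]
      have hgor := hst.gor
      obtain ⟨d, hd⟩ : ∃ d, g + r = d + 1 := ⟨g + r - 1, by omega⟩
      rw [hd] at hgor
      exact one_le_gradeOf_top hgor
    · rwa [(hst.maxReg hL).gradeOf_eq hL]

end Stage
end UniversalLink

/-- Proposition 2.3(b). Let `I` be a Cohen-Macaulay ideal of positive
grade in a Noetherian local Gorenstein ring with infinite residue field, `e ≥ 1`, and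
`C` a proper ideal. Then `L^e(I) ⊆ C·R(X)` if and only if `L^e(I)` is not the unit
ideal and every `R`-ideal linked to `I` in `e` steps is contained in `C`. -/
theorem statement2 (R : Type) [CommRing R] [IsLocalRing R] [IsNoetherianRing R]
    (hGor : IsGorensteinLocalRing R) (hres : Infinite (IsLocalRing.ResidueField R))
    (I : Ideal R) (hCM : IsCMIdeal R I) (hgrade : ∃ r ∈ I, r ∈ nonZeroDivisors R)
    (e : ℕ) (he : 1 ≤ e) (C : Ideal R) (hC : C ≠ ⊤) :
    ∀ (B : CommRingCat.{0}) (φ : R →+* B) (L : Ideal B),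
      IsUniversalLinkOf R e I B φ L →
        (L ≤ C.map φ ↔
          (L ≠ ⊤ ∧ ∀ J : Ideal R, LinkedInSteps R e I J → J ≤ C)) := by
  intro B φ L h
  obtain ⟨g, r, hg1, hG, hg, hD⟩ := UniversalLink.exists_init hGor hCM hgrade
  obtain ⟨_, hst⟩ := UniversalLink.exists_universalStage hg1 hG hg hD h
  constructor
  · intro hle
    refine ⟨fun hL => hst.map_ne_top C hC (top_le_iff.1 (hL ▸ hle)), fun J hJ => ?_⟩
    obtain ⟨J', rfl, hJ'⟩ :=
      hst.exists_chain 0 J (UniversalLink.wChain_of_linkedInSteps (fun _ => hg) hJ)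
    exact hJ' C hC hle
  · rintro ⟨hL, hJ⟩
    exact hst.le_map hL 0 C hJ L rfl
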